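/- arXiv:1611.09639 — 3 statements merged into one kernel-verified Lean document; each statement's English description precedes it below -/
import Mathlib

section
/- Let E be a finite-dimensional normed real algebra and let s be a positive integer. There exist constants K ≥ 1 and C ≥ 1 depending only on E and s such that for all δ > 0, all 0 < ρ ≤ 1/2, and every subset A of E: if A ⊆ B(0, ρ^{-1}) and N_δ(A + A) + N_δ(A + A·A) ≤ ρ^{-1} N_δ(A), then N_δ(⟨A⟩_s) ≤ K ρ^{-C} N_δ(A). -/
open Pointwise

section SeminormDefs

variable {E : Type*} [AddCommGroup E] [Module ℝ E]

/-- Closed ball of radius `r` around `x`, with respect to the (semi)norm `nm`. -/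
def SBall (nm : Seminorm ℝ E) (x : E) (r : ℝ) : Set E := {y | nm (y - x) ≤ r}

/-- Distance from the point `a` to the set `W`, with respect to the (semi)norm `nm`. -/
noncomputable def SDist (nm : Seminorm ℝ E) (a : E) (W : Set E) : ℝ :=
  sInf ((fun w => nm (a - w)) '' W)

/-- Covering number of `S` at scale `δ`: the least number of closed `δ`-balls
(for the norm `nm`) needed to cover `S`. -/
noncomputable def SCov (nm : Seminorm ℝ E) (δ : ℝ) (S : Set E) : ℕ :=
  sInf {N : ℕ | ∃ F : Finset E, F.card ≤ N ∧ S ⊆ ⋃ x ∈ F, SBall nm x δ}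

end SeminormDefs

section AlgDefs

variable {E : Type*} [Ring E] [Algebra ℝ E]

/-- `A` is `ρ`-away from subalgebras: every proper unital subalgebra of `E` has a point of `A`
at distance at least `ρ` from it. -/
def AwayFromSubalgebras (nm : Seminorm ℝ E) (ρ : ℝ) (A : Set E) : Prop :=
  ∀ W : Subalgebra ℝ E, W ≠ ⊤ → ∃ a ∈ A, ρ ≤ SDist nm a (W : Set E)

/-- `GenSet A s` is the set `⟨A⟩_{s+1}` of the paper: `GenSet A 0 = A ∪ (-A) = ⟨A⟩₁` and
`⟨A⟩_{s+1} = ⟨A⟩_s ∪ (⟨A⟩_s + ⟨A⟩₁) ∪ (⟨A⟩_s ⬝ ⟨A⟩₁)`. -/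
def GenSet (A : Set E) : ℕ → Set E
  | 0 => A ∪ (-A)
  | (s + 1) => GenSet A s ∪ (GenSet A s + (A ∪ (-A))) ∪ (GenSet A s * (A ∪ (-A)))

end AlgDefs

section TranslateCovering

variable {E : Type*} [AddCommGroup E]

theorem Set.zero_mem_sub_self {A : Set E} (hA : A.Nonempty) : (0 : E) ∈ A - A :=
  let ⟨a, ha⟩ := hA
  ⟨a, ha, a, ha, sub_self a⟩

theorem Set.neg_nsmul_sub_self (A : Set E) (m : ℕ) : -(m • (A - A)) = m • (A - A) := by
  rw [← neg_nsmul, neg_sub]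

theorem Set.nsmul_sub_self_subset {A : Set E} {m n : ℕ} (hA : A.Nonempty) (hmn : m ≤ n) :
    m • (A - A) ⊆ n • (A - A) :=
  Set.nsmul_right_monotone (Set.zero_mem_sub_self hA) hmn

variable [Module ℝ E]

theorem mem_SBall_zero {nm : Seminorm ℝ E} {x : E} {r : ℝ} : x ∈ SBall nm 0 r ↔ nm x ≤ r := by
  simp [SBall]

/-- `S` is covered, up to an error `T ^ m * δ`, by at most `T ^ m` translates of the `m`-fold sumset
of `A - A`. -/
def TranslateCovered (nm : Seminorm ℝ E) (T δ : ℝ) (A : Set E) (m : ℕ) (S : Set E) : Prop :=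
  ∃ F : Finset E, (F.card : ℝ) ≤ T ^ m ∧
    S ⊆ (F : Set E) + m • (A - A) + SBall nm 0 (T ^ m * δ)

namespace TranslateCovered

variable {nm : Seminorm ℝ E} {T δ : ℝ} {A S S' : Set E} {m n k : ℕ}

theorem subset (h : TranslateCovered nm T δ A m S) (hS : S' ⊆ S) :
    TranslateCovered nm T δ A m S' :=
  let ⟨F, hF, hSF⟩ := h
  ⟨F, hF, hS.trans hSF⟩

theorem mono (hT : 2 ≤ T) (hδ : 0 ≤ δ) (hA : A.Nonempty) (h : TranslateCovered nm T δ A m S)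
    (hmn : m ≤ n) : TranslateCovered nm T δ A n S := by
  obtain ⟨F, hF, hSF⟩ := h
  have hT' : T ^ m ≤ T ^ n := pow_le_pow_right₀ (by linarith) hmn
  refine ⟨F, hF.trans hT', hSF.trans (Set.add_subset_add (Set.add_subset_add_left
    (Set.nsmul_sub_self_subset hA hmn)) fun x hx ↦ ?_)⟩
  rw [mem_SBall_zero] at hx ⊢
  exact hx.trans (by gcongr)

theorem pow_add_pow_le (hT : 2 ≤ T) (m n : ℕ) : T ^ m + T ^ n ≤ T ^ (m + n + 1) := by
  have h1 : T ^ m ≤ T ^ (m + n) := pow_le_pow_right₀ (by linarith) (by omega)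
  have h2 : T ^ n ≤ T ^ (m + n) := pow_le_pow_right₀ (by linarith) (by omega)
  have h3 : 0 ≤ T ^ (m + n) := by positivity
  rw [pow_succ]
  nlinarith

theorem add (hT : 2 ≤ T) (hδ : 0 ≤ δ) (hA : A.Nonempty) (h : TranslateCovered nm T δ A m S)
    (h' : TranslateCovered nm T δ A n S') : TranslateCovered nm T δ A (m + n + 1) (S + S') := by
  classical
  obtain ⟨F, hF, hSF⟩ := h
  obtain ⟨F', hF', hSF'⟩ := h'
  refine ⟨F + F', ?_, ?_⟩
  · calc ((F + F').card : ℝ) ≤ F.card * F'.card := mod_cast Finset.card_add_le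
      _ ≤ T ^ m * T ^ n := by gcongr
      _ = T ^ (m + n) := (pow_add ..).symm
      _ ≤ T ^ (m + n + 1) := pow_le_pow_right₀ (by linarith) (by omega)
  · rintro _ ⟨s, hs, s', hs', rfl⟩
    obtain ⟨_, ⟨f, hf, d, hd, rfl⟩, e, he, rfl⟩ := hSF hs
    obtain ⟨_, ⟨f', hf', d', hd', rfl⟩, e', he', rfl⟩ := hSF' hs'
    rw [mem_SBall_zero] at he he'
    refine ⟨(f + f') + (d + d'), Set.add_mem_add ?_ ?_, e + e', ?_, ?_⟩
    · rw [Finset.coe_add]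
      exact Set.add_mem_add hf hf'
    · refine Set.nsmul_sub_self_subset hA (Nat.le_succ _) ?_
      rw [add_nsmul]
      exact Set.add_mem_add hd hd'
    · rw [mem_SBall_zero]
      calc nm (e + e') ≤ nm e + nm e' := map_add_le_add nm e e'
        _ ≤ (T ^ m + T ^ n) * δ := by linarith
        _ ≤ T ^ (m + n + 1) * δ := by gcongr; exact pow_add_pow_le hT m n
    · beta_reduce
      abel

theorem union (hT : 2 ≤ T) (hδ : 0 ≤ δ) (hA : A.Nonempty) (h : TranslateCovered nm T δ A m S)
    (h' : TranslateCovered nm T δ A n S') : TranslateCovered nm T δ A (m + n + 1) (S ∪ S') := by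
  classical
  obtain ⟨F, hF, hSF⟩ := h
  obtain ⟨F', hF', hSF'⟩ := h'
  refine ⟨F ∪ F', ?_, ?_⟩
  · calc ((F ∪ F').card : ℝ) ≤ F.card + F'.card := mod_cast Finset.card_union_le F F'
      _ ≤ T ^ m + T ^ n := by gcongr
      _ ≤ T ^ (m + n + 1) := pow_add_pow_le hT m n
  · have hball : ∀ {j : ℕ}, j ≤ m + n + 1 →
        SBall nm 0 (T ^ j * δ) ⊆ SBall nm 0 (T ^ (m + n + 1) * δ) := fun hj x hx ↦ by
      rw [mem_SBall_zero] at hx ⊢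
      exact hx.trans (mul_le_mul_of_nonneg_right (pow_le_pow_right₀ (by linarith) hj) hδ)
    rw [Finset.coe_union]
    refine Set.union_subset (hSF.trans ?_) (hSF'.trans ?_)
    · exact Set.add_subset_add (Set.add_subset_add Set.subset_union_left
        (Set.nsmul_sub_self_subset hA (by omega))) (hball (by omega))
    · exact Set.add_subset_add (Set.add_subset_add Set.subset_union_right
        (Set.nsmul_sub_self_subset hA (by omega))) (hball (by omega))

theorem neg (h : TranslateCovered nm T δ A m S) : TranslateCovered nm T δ A m (-S) := by
  classical
  obtain ⟨F, hF, hSF⟩ := h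
  refine ⟨-F, by rwa [Finset.card_neg], fun s hs ↦ ?_⟩
  obtain ⟨_, ⟨f, hf, d, hd, rfl⟩, e, he, hs⟩ := hSF hs
  refine ⟨-f + -d, Set.add_mem_add (by simpa using hf) ?_, -e, ?_, ?_⟩
  · rw [← Set.neg_nsmul_sub_self]
    simpa using hd
  · rw [mem_SBall_zero] at he ⊢
    simpa using he
  · rw [← neg_neg s, ← hs]
    beta_reduce
    abel

theorem biUnion {ι : Type*} (hT : 2 ≤ T) (hδ : 0 ≤ δ) (hA : A.Nonempty) (I : Finset ι)
    (hI : (I.card : ℝ) ≤ T ^ n) {S : ι → Set E}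
    (h : ∀ i ∈ I, TranslateCovered nm T δ A m (S i)) :
    TranslateCovered nm T δ A (m + n) (⋃ i ∈ I, S i) := by
  classical
  choose! F hF hSF using h
  refine ⟨I.biUnion F, ?_, Set.iUnion₂_subset fun i hi ↦ (hSF i hi).trans ?_⟩
  · calc ((I.biUnion F).card : ℝ) ≤ ∑ i ∈ I, ((F i).card : ℝ) := mod_cast Finset.card_biUnion_le
      _ ≤ ∑ i ∈ I, T ^ m := Finset.sum_le_sum hF
      _ = I.card * T ^ m := by simp
      _ ≤ T ^ n * T ^ m := by gcongr
      _ = T ^ (m + n) := by ring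
  · refine Set.add_subset_add (Set.add_subset_add ?_ (Set.nsmul_sub_self_subset hA (by omega)))
      fun x hx ↦ ?_
    · exact_mod_cast Finset.subset_biUnion_of_mem F hi
    · rw [mem_SBall_zero] at hx ⊢
      exact hx.trans (mul_le_mul_of_nonneg_right
        (pow_le_pow_right₀ (by linarith) (by omega)) hδ)

theorem ball (hT : 2 ≤ T) (hA : A.Nonempty) (m : ℕ) :
    TranslateCovered nm T δ A m (SBall nm 0 (T ^ m * δ)) := by
  refine ⟨{0}, by simpa using one_le_pow₀ (by linarith), fun x hx ↦ ⟨0, ?_, x, hx, by simp⟩⟩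
  exact ⟨0, by simp, 0, Set.nsmul_sub_self_subset hA (Nat.zero_le m) (by simp), by simp⟩

theorem finset (hδ : 0 ≤ δ) (hT : 2 ≤ T) (hA : A.Nonempty) {F : Finset E}
    (hF : (F.card : ℝ) ≤ T ^ m) : TranslateCovered nm T δ A m F := by
  refine ⟨F, hF, fun x hx ↦ ⟨x, ⟨x, hx, 0, Set.nsmul_sub_self_subset hA (Nat.zero_le m) (by simp),
    by simp⟩, 0, ?_, by simp⟩⟩
  rw [mem_SBall_zero, map_zero]
  positivity

theorem self (hT : 2 ≤ T) (hδ : 0 ≤ δ) (hA : A.Nonempty) : TranslateCovered nm T δ A 1 A := by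
  obtain ⟨a, ha⟩ := hA
  refine ⟨{a}, by simp; linarith, fun x hx ↦ ⟨x, ⟨a, by simp, x - a, ?_, by simp⟩, 0, ?_, by simp⟩⟩
  · rw [one_nsmul]
    exact Set.sub_mem_sub hx ha
  · rw [mem_SBall_zero, map_zero]
    positivity

theorem nsmul (hT : 2 ≤ T) (hδ : 0 ≤ δ) (hA : A.Nonempty) (h : TranslateCovered nm T δ A m S)
    (k : ℕ) : TranslateCovered nm T δ A (k * (m + 1)) (k • S) := by
  induction k with
  | zero =>
    refine (ball hT hA 0).subset ?_ |>.mono hT hδ hA (Nat.zero_le _)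
    simp [mem_SBall_zero, hδ]
  | succ k ih =>
    rw [succ_nsmul]
    exact (ih.add hT hδ hA h).mono hT hδ hA (by ring_nf; omega)

/-- The translates may be centred at points of the covered set. -/
theorem exists_subset (hT : 2 ≤ T) (hδ : 0 ≤ δ)
    (h : TranslateCovered nm T δ A m S) :
    ∃ F : Finset E, (F : Set E) ⊆ S ∧ (F.card : ℝ) ≤ T ^ m ∧
      S ⊆ (F : Set E) + (2 * m) • (A - A) + SBall nm 0 (T ^ (m + 1) * δ) := by
  classical
  obtain ⟨F, hF, hSF⟩ := h
  let G := F.filter fun f ↦ (S ∩ ({f} + m • (A - A) + SBall nm 0 (T ^ m * δ))).Nonempty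
  have hG : ∀ f ∈ G, (S ∩ ({f} + m • (A - A) + SBall nm 0 (T ^ m * δ))).Nonempty :=
    fun f hf ↦ (Finset.mem_filter.1 hf).2
  choose! y hyS hy using hG
  refine ⟨G.image y, ?_, ?_, fun s hs ↦ ?_⟩
  · intro x hx
    obtain ⟨f, hf, rfl⟩ := Finset.mem_image.1 (Finset.mem_coe.1 hx)
    exact hyS f hf
  · calc ((G.image y).card : ℝ) ≤ F.card :=
          mod_cast Finset.card_image_le.trans (Finset.card_filter_le _ _)
      _ ≤ T ^ m := hF
  · obtain ⟨_, ⟨f, hf, d, hd, rfl⟩, e, he, rfl⟩ := hSF hs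
    have hfG : f ∈ G := Finset.mem_filter.2 ⟨hf, f + d + e, hs,
      Set.add_mem_add (Set.add_mem_add rfl hd) he⟩
    obtain ⟨_, ⟨f', hf', d', hd', rfl⟩, e', he', hy'⟩ := hy f hfG
    rw [Set.mem_singleton_iff.1 hf'] at hy'
    rw [mem_SBall_zero] at he he'
    refine ⟨y f + (d + -d'), Set.add_mem_add (by simpa using ⟨f, hfG, rfl⟩) ?_, e - e', ?_, ?_⟩
    · rw [two_mul, add_nsmul]
      refine Set.add_mem_add hd ?_
      rw [← Set.neg_nsmul_sub_self]
      simpa using hd'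
    · rw [mem_SBall_zero]
      calc nm (e - e') ≤ nm e + nm e' := map_sub_le_add nm e e'
        _ ≤ 2 * (T ^ m * δ) := by linarith
        _ ≤ T * (T ^ m * δ) := by gcongr
        _ = T ^ (m + 1) * δ := by ring
    · rw [← hy']
      beta_reduce
      abel

end TranslateCovered

end TranslateCovering

section GeneratedSets

variable {E : Type*} [Ring E]

theorem Set.nsmul_mul_subset (S U : Set E) (m : ℕ) : (m • S) * U ⊆ m • (S * U) := by
  induction m with
  | zero => rintro _ ⟨x, hx, u, -, rfl⟩; simp_all
  | succ m ih =>
    rw [succ_nsmul, succ_nsmul]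
    exact (Set.add_mul_subset ..).trans (Set.add_subset_add_right ih)

theorem Set.mul_nsmul_subset (S U : Set E) (m : ℕ) : U * (m • S) ⊆ m • (U * S) := by
  induction m with
  | zero => rintro _ ⟨u, -, x, hx, rfl⟩; simp_all
  | succ m ih =>
    rw [succ_nsmul, succ_nsmul]
    exact (Set.mul_add_subset ..).trans (Set.add_subset_add_right ih)

theorem Set.sub_mul_subset_sub (S S' U : Set E) : (S - S') * U ⊆ S * U - S' * U := by
  rintro _ ⟨_, ⟨s, hs, s', hs', rfl⟩, u, hu, rfl⟩
  exact ⟨s * u, Set.mul_mem_mul hs hu, s' * u, Set.mul_mem_mul hs' hu, (sub_mul s s' u).symm⟩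

theorem Set.mul_sub_subset_sub (S S' U : Set E) : U * (S - S') ⊆ U * S - U * S' := by
  rintro _ ⟨u, hu, _, ⟨s, hs, s', hs', rfl⟩, rfl⟩
  exact ⟨u * s, Set.mul_mem_mul hu hs, u * s', Set.mul_mem_mul hu hs', (mul_sub u s s').symm⟩

variable [Algebra ℝ E]

/-- `A` is bounded and `A * A` is covered by few translates of `A - A`. -/
structure ProductControlled (nm : Seminorm ℝ E) (T δ : ℝ) (A : Set E) : Prop where
  two_le : 2 ≤ T
  scale_nonneg : 0 ≤ δ
  nonempty : A.Nonempty
  mul_le : ∀ x y, nm (x * y) ≤ T * nm x * nm y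
  norm_le : ∀ a ∈ A, nm a ≤ T
  mul_covered : TranslateCovered nm T δ A 1 (A * A)

namespace ProductControlled

variable {nm : Seminorm ℝ E} {T δ : ℝ} {A S : Set E} {m n j : ℕ}

theorem norm_le_of_mem_union_neg (h : ProductControlled nm T δ A) {a : E} (ha : a ∈ A ∪ -A) :
    nm a ≤ T := by
  rcases ha with ha | ha
  · exact h.norm_le a ha
  · simpa using h.norm_le (-a) ha

theorem norm_le_of_mem_genSet (h : ProductControlled nm T δ A) (s : ℕ) {y : E}
    (hy : y ∈ GenSet A s) : nm y ≤ T ^ (2 * s + 1) := by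
  have hT := h.two_le
  induction s generalizing y with
  | zero => simpa using h.norm_le_of_mem_union_neg hy
  | succ s ih =>
    have hle : T ≤ T ^ (2 * s + 1) := le_self_pow₀ (by linarith) (by omega)
    rcases hy with (hy | ⟨y, hy, a, ha, rfl⟩) | ⟨y, hy, a, ha, rfl⟩
    · exact (ih hy).trans (pow_le_pow_right₀ (by linarith) (by omega))
    · calc nm (y + a) ≤ nm y + nm a := map_add_le_add nm y a
        _ ≤ T ^ (2 * s + 1) + T ^ (2 * s + 1) :=
          add_le_add (ih hy) ((h.norm_le_of_mem_union_neg ha).trans hle)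
        _ = 2 * T ^ (2 * s + 1) := by ring
        _ ≤ T * T ^ (2 * s + 1) := by gcongr
        _ = T ^ (2 * s + 2) := by ring
        _ ≤ T ^ (2 * (s + 1) + 1) := pow_le_pow_right₀ (by linarith) (by omega)
    · calc nm (y * a) ≤ T * nm y * nm a := h.mul_le y a
        _ ≤ T * T ^ (2 * s + 1) * T := by
          gcongr
          exacts [ih hy, h.norm_le_of_mem_union_neg ha]
        _ = T ^ (2 * (s + 1) + 1) := by ring

theorem singleton_mul_covered (h : ProductControlled nm T δ A) {y : E} (hy : nm y ≤ T ^ j)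
    (hyA : TranslateCovered nm T δ A n ({y} * A)) (hS : TranslateCovered nm T δ A m S) :
    TranslateCovered nm T δ A (m + m * (n + n + 1 + 1) + 1 + (j + m + 1) + 1) ({y} * S) := by
  classical
  obtain ⟨hT, hδ, hA, hmul, -, -⟩ := h
  obtain ⟨F, hF, hSF⟩ := hS
  have hyF : TranslateCovered nm T δ A m ((({y} : Finset E) * F : Finset E) : Set E) := by
    refine .finset hδ hT hA (le_trans ?_ hF)
    simpa using! Finset.card_mul_le (s := {y}) (t := F)
  have hyA' : TranslateCovered nm T δ A (n + n + 1) ({y} * A - {y} * A) := by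
    rw [sub_eq_add_neg]
    exact hyA.add hT hδ hA hyA.neg
  refine ((hyF.add hT hδ hA (hyA'.nsmul hT hδ hA m)).add hT hδ hA (.ball hT hA _)).subset ?_
  rw [Finset.coe_mul, Finset.coe_singleton]
  refine (Set.mul_subset_mul_left hSF).trans ((Set.mul_add_subset ..).trans
    (Set.add_subset_add ((Set.mul_add_subset ..).trans (Set.add_subset_add_left ?_)) ?_))
  · exact (Set.mul_nsmul_subset ..).trans (Set.nsmul_subset_nsmul_left (Set.mul_sub_subset_sub ..))
  · rintro _ ⟨_, rfl, e, he, rfl⟩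
    rw [mem_SBall_zero] at he ⊢
    calc nm (_ * e) ≤ T * nm _ * nm e := hmul _ e
      _ ≤ T * T ^ j * (T ^ m * δ) := by gcongr
      _ = T ^ (j + m + 1) * δ := by ring

theorem self_union_neg_covered (h : ProductControlled nm T δ A) :
    TranslateCovered nm T δ A 3 (A ∪ -A) :=
  have hA := TranslateCovered.self h.two_le h.scale_nonneg h.nonempty (nm := nm)
  hA.union h.two_le h.scale_nonneg h.nonempty hA.neg

theorem exists_singleton_mul_covered (nm : Seminorm ℝ E) (s : ℕ) :
    ∃ m, ∀ (T δ : ℝ) (A : Set E), ProductControlled nm T δ A →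
      ∀ y ∈ GenSet A s, TranslateCovered nm T δ A m ({y} * A) := by
  have base {T δ : ℝ} {A : Set E} (h : ProductControlled nm T δ A) {y : E} (hy : y ∈ A ∪ -A) :
      TranslateCovered nm T δ A 1 ({y} * A) := by
    rcases hy with hy | hy
    · exact h.mul_covered.subset (Set.mul_subset_mul_right (by simpa using hy))
    · refine h.mul_covered.neg.subset ?_
      rw [← neg_mul]
      exact Set.mul_subset_mul_right (by simpa using hy)
  induction s with
  | zero => exact ⟨1, fun T δ A h y hy ↦ base h hy⟩
  | succ s ih =>
    obtain ⟨m, ih⟩ := ih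
    refine ⟨(m + 1 + 1) + (1 + 1 * (m + m + 1 + 1) + 1 + (2 * s + 1 + 1 + 1) + 1),
      fun T δ A h y hy ↦ ?_⟩
    rcases hy with (hy | ⟨y, hy, a, ha, rfl⟩) | ⟨y, hy, a, ha, rfl⟩
    · exact (ih T δ A h y hy).mono h.two_le h.scale_nonneg h.nonempty (by omega)
    · refine (((ih T δ A h y hy).add h.two_le h.scale_nonneg h.nonempty (base h ha)).subset
        ?_).mono h.two_le h.scale_nonneg h.nonempty (Nat.le_add_right _ _)
      rw [← Set.singleton_add_singleton]
      exact Set.add_mul_subset ..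
    · refine ((h.singleton_mul_covered (h.norm_le_of_mem_genSet s hy) (ih T δ A h y hy)
        (base h ha)).subset ?_).mono h.two_le h.scale_nonneg h.nonempty (Nat.le_add_left _ _)
      rw [← Set.singleton_mul_singleton, mul_assoc]

theorem mul_self_covered (h : ProductControlled nm T δ A)
    (hn : ∀ y ∈ S, TranslateCovered nm T δ A n ({y} * A))
    (hS : TranslateCovered nm T δ A m S) :
    TranslateCovered nm T δ A ((n + m) + 2 * m * (1 + 1 + 1 + 1) + 1 + (m + 3) + 1) (S * A) := by
  obtain ⟨F, hFS, hF, hSF⟩ := hS.exists_subset h.two_le h.scale_nonneg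
  obtain ⟨hT, hδ, hA, hmul, hAT, hAA⟩ := h
  have hFA : TranslateCovered nm T δ A (n + m) (⋃ f ∈ F, {f} * A) :=
    .biUnion hT hδ hA F hF fun f hf ↦ hn f (hFS hf)
  have hAA' : TranslateCovered nm T δ A (1 + 1 + 1) (A * A - A * A) := by
    rw [sub_eq_add_neg]
    exact hAA.add hT hδ hA hAA.neg
  refine ((hFA.add hT hδ hA (hAA'.nsmul hT hδ hA (2 * m))).add hT hδ hA (.ball hT hA _)).subset ?_
  refine (Set.mul_subset_mul_right hSF).trans ((Set.add_mul_subset ..).trans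
    (Set.add_subset_add ((Set.add_mul_subset ..).trans (Set.add_subset_add ?_ ?_)) ?_))
  · rintro _ ⟨f, hf, a, ha, rfl⟩
    exact Set.mem_biUnion hf (Set.mul_mem_mul rfl ha)
  · exact (Set.nsmul_mul_subset ..).trans (Set.nsmul_subset_nsmul_left (Set.sub_mul_subset_sub ..))
  · rintro _ ⟨e, he, a, ha, rfl⟩
    rw [mem_SBall_zero] at he ⊢
    calc nm (e * a) ≤ T * nm e * nm a := hmul e a
      _ ≤ T * (T ^ (m + 1) * δ) * T := by
        gcongr
        exact hAT a ha
      _ = T ^ (m + 3) * δ := by ring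

theorem exists_genSet_covered (nm : Seminorm ℝ E) (s : ℕ) :
    ∃ m, ∀ (T δ : ℝ) (A : Set E), ProductControlled nm T δ A →
      TranslateCovered nm T δ A m (GenSet A s) := by
  induction s with
  | zero => exact ⟨3, fun T δ A h ↦ h.self_union_neg_covered⟩
  | succ s ih =>
    obtain ⟨m, ih⟩ := ih
    obtain ⟨n, hn⟩ := exists_singleton_mul_covered nm s
    let p := (n + m) + 2 * m * (1 + 1 + 1 + 1) + 1 + (m + 3) + 1
    refine ⟨(m + (m + 3 + 1) + 1) + (p + p + 1) + 1, fun T δ A h ↦ ?_⟩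
    obtain ⟨hT, hδ, hA, -⟩ := id h
    have hS := ih T δ A h
    have hmul := h.mul_self_covered (hn T δ A h) hS
    refine ((hS.union hT hδ hA (hS.add hT hδ hA h.self_union_neg_covered)).union hT hδ hA
      (hmul.union hT hδ hA hmul.neg)).subset (Set.union_subset_union_right _ ?_)
    rw [Set.mul_union, mul_neg]

end ProductControlled

end GeneratedSets

section Lattice

variable {E : Type*} [AddCommGroup E] [Module ℝ E]

theorem exists_abs_repr_le [FiniteDimensional ℝ E] (nm : Seminorm ℝ E)
    (hnm : ∀ x : E, nm x = 0 → x = 0) {ι : Type*} [Finite ι] (b : Module.Basis ι ℝ E) :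
    ∃ c : ℝ, 1 ≤ c ∧ ∀ x i, |b.repr x i| ≤ c * nm x := by
  have := Fintype.ofFinite ι
  let : Norm E := ⟨nm⟩
  have core : NormedSpace.Core ℝ E :=
    { norm_nonneg := fun x ↦ apply_nonneg nm x
      norm_smul := fun r x ↦ map_smul_eq_mul nm r x
      norm_triangle := fun x y ↦ map_add_le_add nm x y
      norm_eq_zero_iff := fun x ↦ ⟨hnm x, fun hx ↦ by rw [hx]; exact map_zero nm⟩ }
  let : NormedAddCommGroup E := NormedAddCommGroup.ofCore core
  let : NormedSpace ℝ E := NormedSpace.ofCore core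
  let f : E →L[ℝ] (ι → ℝ) := LinearMap.toContinuousLinearMap b.equivFun.toLinearMap
  refine ⟨max 1 ‖f‖, le_max_left _ _, fun x i ↦ ?_⟩
  calc |b.repr x i| = ‖f x i‖ := rfl
    _ ≤ ‖f x‖ := norm_le_pi_norm (f x) i
    _ ≤ ‖f‖ * ‖x‖ := f.le_opNorm x
    _ ≤ max 1 ‖f‖ * nm x := mul_le_mul_of_nonneg_right (le_max_right _ _) (apply_nonneg nm x)

theorem Seminorm.map_sum_le (nm : Seminorm ℝ E) {ι : Type*} (I : Finset ι) (f : ι → E) :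
    nm (∑ i ∈ I, f i) ≤ ∑ i ∈ I, nm (f i) :=
  Finset.le_sum_of_subadditive nm (map_zero nm).le (map_add_le_add nm) I f

theorem seminorm_le_of_abs_repr_le (nm : Seminorm ℝ E) {ι : Type*} [Fintype ι]
    (b : Module.Basis ι ℝ E) {r : ℝ} {x : E} (hx : ∀ i, |b.repr x i| ≤ r) :
    nm x ≤ r * ∑ i, nm (b i) := by
  conv_lhs => rw [← b.sum_repr x]
  rw [Finset.mul_sum]
  refine (nm.map_sum_le _ _).trans (Finset.sum_le_sum fun i _ ↦ ?_)
  rw [map_smul_eq_mul, Real.norm_eq_abs]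
  exact mul_le_mul_of_nonneg_right (hx i) (apply_nonneg nm _)

theorem exists_seminorm_mul_le {E : Type*} [Ring E] [Algebra ℝ E] [FiniteDimensional ℝ E]
    (nm : Seminorm ℝ E) (hnm : ∀ x : E, nm x = 0 → x = 0) :
    ∃ M : ℝ, 0 ≤ M ∧ ∀ x y, nm (x * y) ≤ M * nm x * nm y := by
  let b := Module.finBasis ℝ E
  obtain ⟨c, hc, hb⟩ := exists_abs_repr_le nm hnm b
  refine ⟨c * c * ∑ i, ∑ j, nm (b i * b j), mul_nonneg (by positivity)
    (Finset.sum_nonneg fun i _ ↦ Finset.sum_nonneg fun j _ ↦ apply_nonneg nm _), fun x y ↦ ?_⟩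
  have hsum : x * y = ∑ i, ∑ j, (b.repr x i * b.repr y j) • (b i * b j) := by
    conv_lhs => rw [← b.sum_repr x, ← b.sum_repr y]
    simp_rw [Finset.sum_mul_sum, smul_mul_smul_comm]
  have hx := apply_nonneg nm x
  calc nm (x * y) ≤ ∑ i, ∑ j, nm ((b.repr x i * b.repr y j) • (b i * b j)) := by
        rw [hsum]
        exact (nm.map_sum_le _ _).trans
          (Finset.sum_le_sum fun i _ ↦ nm.map_sum_le _ _)
    _ ≤ ∑ i, ∑ j, (c * nm x * (c * nm y)) * nm (b i * b j) := by
        gcongr with i _ j _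
        rw [map_smul_eq_mul, norm_mul, Real.norm_eq_abs, Real.norm_eq_abs]
        gcongr
        exacts [hb x i, hb y j]
    _ = c * c * (∑ i, ∑ j, nm (b i * b j)) * nm x * nm y := by
        simp_rw [← Finset.mul_sum]
        ring

/-- A lattice in `E` parametrized by `ℤⁿ`, together with a rounding map `E → ℤⁿ` of precision `δ`,
such that
balls of radius `R * δ` contain at most `(c * (R + 1)) ^ n` lattice points. -/
structure LatticeRounding (nm : Seminorm ℝ E) (δ c : ℝ) (n : ℕ) where
  toHom : (Fin n → ℤ) →+ E
  round : E → (Fin n → ℤ)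
  seminorm_sub_le : ∀ x, nm (x - toHom (round x)) ≤ δ
  exists_finset : ∀ R : ℝ, 0 ≤ R → ∃ Λ : Finset (Fin n → ℤ),
    (Λ.card : ℝ) ≤ (c * (R + 1)) ^ n ∧ ∀ z, nm (toHom z) ≤ R * δ → z ∈ Λ

theorem exists_latticeRounding [FiniteDimensional ℝ E] (nm : Seminorm ℝ E)
    (hnm : ∀ x : E, nm x = 0 → x = 0) :
    ∃ n : ℕ, ∃ c : ℝ, 1 ≤ c ∧ ∀ δ : ℝ, 0 < δ → Nonempty (LatticeRounding nm δ c n) := by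
  let b := Module.finBasis ℝ E
  obtain ⟨c, hc, hb⟩ := exists_abs_repr_le nm hnm b
  set B : ℝ := ∑ i, nm (b i) with hB
  have hB0 : 0 ≤ B := Finset.sum_nonneg fun i _ ↦ apply_nonneg nm _
  refine ⟨Module.finrank ℝ E, 2 * (c * (B + 1)), by nlinarith, fun δ hδ ↦ ⟨?_⟩⟩
  set η : ℝ := δ / (B + 1) with hη
  have hη0 : 0 < η := by positivity
  let φ : (Fin (Module.finrank ℝ E) → ℤ) →+ E :=
    { toFun := fun z ↦ ∑ i, (η * z i) • b i
      map_zero' := by simp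
      map_add' := fun z w ↦ by simp [mul_add, add_smul, Finset.sum_add_distrib] }
  have hφ : ∀ z i, b.repr (φ z) i = η * z i := fun z i ↦ by
    change b.repr (∑ i, (η * z i) • b i) i = _
    rw [b.repr_sum_self]
  refine ⟨φ, fun x i ↦ _root_.round (b.repr x i / η), fun x ↦ ?_, fun R hR ↦ ?_⟩
  · refine (seminorm_le_of_abs_repr_le nm b (r := η) fun i ↦ ?_).trans ?_
    · have h := abs_sub_round (b.repr x i / η)
      rw [map_sub, Finsupp.sub_apply, hφ]
      calc |b.repr x i - η * (_root_.round (b.repr x i / η) : ℤ)|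
          = η * |b.repr x i / η - (_root_.round (b.repr x i / η) : ℤ)| := by
            rw [← abs_of_pos hη0, ← abs_mul, abs_of_pos hη0, mul_sub, mul_div_cancel₀ _ hη0.ne']
        _ ≤ η * (1 / 2) := by gcongr
        _ ≤ η := by linarith
    · rw [← hB, hη, div_mul_eq_mul_div, div_le_iff₀ (by positivity)]
      nlinarith
  · let N : ℕ := ⌊c * (B + 1) * R⌋₊
    have hN : (N : ℝ) ≤ c * (B + 1) * R := Nat.floor_le (by positivity)
    refine ⟨Fintype.piFinset fun _ ↦ Finset.Icc (-(N : ℤ)) N, ?_, fun z hz ↦ ?_⟩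
    · have hcard : (Finset.Icc (-(N : ℤ)) N).card = 2 * N + 1 := by
        rw [Int.card_Icc]; omega
      rw [Fintype.card_piFinset, Finset.prod_const, hcard, Finset.card_univ, Fintype.card_fin]
      push_cast
      gcongr
      have : 1 ≤ c * (B + 1) := by nlinarith
      linarith
    · rw [Fintype.mem_piFinset]
      intro i
      have h := hb (φ z) i
      rw [hφ, abs_mul, abs_of_pos hη0] at h
      have h1 : η * |(z i : ℝ)| ≤ η * (c * (B + 1) * R) := by
        calc η * |(z i : ℝ)| ≤ c * nm (φ z) := h
          _ ≤ c * (R * δ) := by gcongr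
          _ = η * (c * (B + 1) * R) := by rw [hη]; field_simp
      have h2 : ((z i).natAbs : ℝ) ≤ c * (B + 1) * R := by
        rw [Nat.cast_natAbs, Int.cast_abs]
        exact le_of_mul_le_mul_left h1 hη0
      have h3 : (z i).natAbs ≤ N := Nat.le_floor h2
      rw [Finset.mem_Icc]
      omega

end Lattice

section Covering

variable {E : Type*} [AddCommGroup E] [Module ℝ E] {nm : Seminorm ℝ E} {δ : ℝ} {S A : Set E}

theorem SCov_le_card {F : Finset E} (hF : S ⊆ ⋃ x ∈ F, SBall nm x δ) : SCov nm δ S ≤ F.card :=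
  Nat.sInf_le ⟨F, le_rfl, hF⟩

theorem exists_card_le_SCov (h : ∃ F : Finset E, S ⊆ ⋃ x ∈ F, SBall nm x δ) :
    ∃ F : Finset E, F.card ≤ SCov nm δ S ∧ S ⊆ ⋃ x ∈ F, SBall nm x δ :=
  Nat.sInf_mem (s := {N : ℕ | ∃ F : Finset E, F.card ≤ N ∧ S ⊆ ⋃ x ∈ F, SBall nm x δ})
    (let ⟨F, hF⟩ := h; ⟨F.card, F, le_rfl, hF⟩)

namespace LatticeRounding

variable {c : ℝ} {n : ℕ}

theorem SCov_le_card (L : LatticeRounding nm δ c n) {Z : Finset (Fin n → ℤ)}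
    (hZ : ∀ x ∈ S, L.round x ∈ Z) : SCov nm δ S ≤ Z.card := by
  classical
  refine (_root_.SCov_le_card (F := Z.image L.toHom) fun x hx ↦ ?_).trans Finset.card_image_le
  exact Set.mem_biUnion (Finset.mem_image_of_mem _ (hZ x hx)) (L.seminorm_sub_le x)

theorem exists_cover (L : LatticeRounding nm δ c n) (hδ : 0 < δ) {R : ℝ}
    (hS : ∀ x ∈ S, nm x ≤ R) : ∃ F : Finset E, S ⊆ ⋃ x ∈ F, SBall nm x δ := by
  classical
  obtain ⟨Λ, -, hΛ⟩ := L.exists_finset (|R| / δ + 1) (by positivity)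
  refine ⟨Λ.image L.toHom, fun x hx ↦ Set.mem_biUnion
    (Finset.mem_image_of_mem _ (hΛ (L.round x) ?_)) (L.seminorm_sub_le x)⟩
  calc nm (L.toHom (L.round x)) = nm (x - (x - L.toHom (L.round x))) := by rw [sub_sub_cancel]
    _ ≤ nm x + nm (x - L.toHom (L.round x)) := map_sub_le_add nm _ _
    _ ≤ |R| + δ := add_le_add ((hS x hx).trans (le_abs_self R)) (L.seminorm_sub_le x)
    _ = (|R| / δ + 1) * δ := by field_simp

theorem exists_finset_of_near (L : LatticeRounding nm δ c n) (hδ : 0 < δ) {R : ℝ}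
    (hS : ∀ x ∈ S, nm x ≤ R) {r : ℝ} (hr : 0 ≤ r) :
    ∃ Z : Finset (Fin n → ℤ), (Z.card : ℝ) ≤ (c * (r + 3)) ^ n * SCov nm δ S ∧
      ∀ x ∈ S, ∀ z, nm (x - L.toHom z) ≤ r * δ → z ∈ Z := by
  classical
  obtain ⟨F, hF, hSF⟩ := exists_card_le_SCov (L.exists_cover hδ hS)
  obtain ⟨Λ, hΛ, hΛz⟩ := L.exists_finset (r + 2) (by positivity)
  refine ⟨Λ + F.image L.round, ?_, fun x hx z hz ↦ ?_⟩
  · calc ((Λ + F.image L.round).card : ℝ) ≤ Λ.card * (F.image L.round).card :=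
          mod_cast Finset.card_add_le
      _ ≤ (c * (r + 2 + 1)) ^ n * SCov nm δ S := by
          gcongr
          · exact (Nat.cast_nonneg _).trans hΛ
          · exact Finset.card_image_le.trans hF
      _ = (c * (r + 3)) ^ n * SCov nm δ S := by ring
  · obtain ⟨f, hf, hxf⟩ := Set.mem_iUnion₂.1 (hSF hx)
    refine Finset.mem_add.2 ⟨z - L.round f, hΛz _ ?_, L.round f, Finset.mem_image_of_mem _ hf,
      sub_add_cancel _ _⟩
    have hxf' : nm (x - f) ≤ δ := hxf
    have key : L.toHom (z - L.round f) =
        (x - f) + (f - L.toHom (L.round f)) - (x - L.toHom z) := by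
      rw [map_sub]; abel
    have h1 := map_sub_le_add nm ((x - f) + (f - L.toHom (L.round f))) (x - L.toHom z)
    have h2 := map_add_le_add nm (x - f) (f - L.toHom (L.round f))
    have h3 := L.seminorm_sub_le f
    rw [key]
    linarith

theorem exists_nsmul_near (L : LatticeRounding nm δ c n) {A' : Finset (Fin n → ℤ)}
    (hA' : ∀ a ∈ A, L.round a ∈ A') (m : ℕ) {d : E} (hd : d ∈ m • (A - A)) :
    ∃ w ∈ m • (A' - A'), nm (d - L.toHom w) ≤ 2 * m * δ := by
  induction m generalizing d with
  | zero =>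
    rw [zero_nsmul, Set.mem_zero] at hd
    exact ⟨0, by simp, by simp [hd]⟩
  | succ m ih =>
    rw [succ_nsmul] at hd
    obtain ⟨d, hd, _, ⟨a, ha, b, hb, rfl⟩, rfl⟩ := hd
    obtain ⟨w, hw, hdw⟩ := ih hd
    refine ⟨w + (L.round a - L.round b), ?_, ?_⟩
    · rw [succ_nsmul]
      exact Finset.add_mem_add hw (Finset.sub_mem_sub (hA' a ha) (hA' b hb))
    · have key : d + (a - b) - L.toHom (w + (L.round a - L.round b)) =
          (d - L.toHom w) + ((a - L.toHom (L.round a)) - (b - L.toHom (L.round b))) := by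
        rw [map_add, map_sub]; abel
      have h1 := map_add_le_add nm (d - L.toHom w)
        ((a - L.toHom (L.round a)) - (b - L.toHom (L.round b)))
      have h2 := map_sub_le_add nm (a - L.toHom (L.round a)) (b - L.toHom (L.round b))
      have h3 := L.seminorm_sub_le a
      have h4 := L.seminorm_sub_le b
      beta_reduce
      rw [key]
      push_cast
      linarith

theorem SCov_le_of_translateCovered (L : LatticeRounding nm δ c n) {T : ℝ} {m : ℕ}
    (hT : 0 ≤ T) {A' : Finset (Fin n → ℤ)} (hA' : ∀ a ∈ A, L.round a ∈ A')
    (hS : TranslateCovered nm T δ A m S) :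
    (SCov nm δ S : ℝ) ≤
      T ^ m * (m • (A' - A')).card * (c * (2 * m + T ^ m + 3)) ^ n := by
  classical
  obtain ⟨F, hF, hSF⟩ := hS
  obtain ⟨Λ, hΛ, hΛz⟩ := L.exists_finset (2 * m + T ^ m + 2) (by positivity)
  have hcov : ∀ x ∈ S, L.round x ∈ F.image L.round + m • (A' - A') + Λ := by
    intro x hx
    obtain ⟨_, ⟨f, hf, d, hd, rfl⟩, e, he, rfl⟩ := hSF hx
    rw [mem_SBall_zero] at he
    obtain ⟨w, hw, hdw⟩ := L.exists_nsmul_near hA' m hd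
    beta_reduce
    set x := f + d + e with hx
    refine Finset.mem_add.2 ⟨L.round f + w, Finset.add_mem_add (Finset.mem_image_of_mem _ hf) hw,
      L.round x - (L.round f + w), hΛz _ ?_, add_sub_cancel _ _⟩
    have key : L.toHom (L.round x - (L.round f + w)) =
        ((f - L.toHom (L.round f)) + (d - L.toHom w)) + (e - (x - L.toHom (L.round x))) := by
      rw [map_sub, map_add, hx]; abel
    have h1 := map_add_le_add nm ((f - L.toHom (L.round f)) + (d - L.toHom w))
      (e - (x - L.toHom (L.round x)))
    have h2 := map_add_le_add nm (f - L.toHom (L.round f)) (d - L.toHom w)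
    have h3 := map_sub_le_add nm e (x - L.toHom (L.round x))
    have h4 := L.seminorm_sub_le x
    have h5 := L.seminorm_sub_le f
    rw [key]
    linarith
  calc (SCov nm δ S : ℝ) ≤ (F.image L.round + m • (A' - A') + Λ).card :=
        mod_cast L.SCov_le_card hcov
    _ ≤ ((F.image L.round).card * (m • (A' - A')).card * Λ.card : ℕ) :=
        mod_cast Finset.card_add_le.trans (Nat.mul_le_mul_right _ Finset.card_add_le)
    _ ≤ F.card * (m • (A' - A')).card * Λ.card := by
        push_cast
        gcongr
        exact Finset.card_image_le
    _ ≤ T ^ m * (m • (A' - A')).card * (c * (2 * m + T ^ m + 2 + 1)) ^ n := by gcongr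
    _ = T ^ m * (m • (A' - A')).card * (c * (2 * m + T ^ m + 3)) ^ n := by ring_nf

end LatticeRounding

end Covering

theorem card_nsmul_sub_le {G : Type*} [AddCommGroup G] [DecidableEq G] {B : Finset G} {T : ℝ}
    (hB : B.Nonempty) (hT : ((B + B).card : ℝ) ≤ T * B.card) (m : ℕ) :
    ((m • (B - B)).card : ℝ) ≤ T ^ (2 * m) * B.card := by
  have hB0 : (0 : ℝ) < B.card := mod_cast hB.card_pos
  have h := Finset.pluennecke_ruzsa_inequality_nsmul_sub_nsmul_add hB B m m
  have h' : ((m • B - m • B).card : ℝ) ≤ ((B + B).card / B.card) ^ (m + m) * B.card := by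
    simpa using (NNRat.cast_le (K := ℝ)).2 h
  rw [nsmul_sub, two_mul]
  refine h'.trans ?_
  gcongr
  exact (div_le_iff₀ hB0).2 hT

theorem genSet_empty {E : Type*} [Ring E] [Algebra ℝ E] (s : ℕ) : GenSet (∅ : Set E) s = ∅ := by
  induction s with
  | zero => simp [GenSet]
  | succ s ih => simp [GenSet, ih]

namespace LatticeRounding

variable {E : Type*} [Ring E] [Algebra ℝ E] {nm : Seminorm ℝ E} {δ c : ℝ} {n : ℕ} {A : Set E}

/-- Ruzsa's covering lemma at scale `δ`, applied to `A + A * A`. -/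
theorem translateCovered_mul (L : LatticeRounding nm δ c n) {T : ℝ} (hT : 3 ≤ T) (hδ : 0 ≤ δ)
    {A' P Z : Finset (Fin n → ℤ)} (hA : A'.Nonempty) (hA' : ↑A' = L.round '' A)
    (hP : ↑P = L.round '' (A * A)) (hPA : P + A' ⊆ Z) (hZ : (Z.card : ℝ) ≤ T * A'.card) :
    TranslateCovered nm T δ A 1 (A * A) := by
  classical
  obtain ⟨X, -, hX, hPX⟩ := Finset.ruzsa_covering_add hA
    ((Nat.cast_le.2 (Finset.card_le_card hPA)).trans hZ)
  refine ⟨X.image L.toHom, ?_, fun p hp ↦ ?_⟩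
  · rw [pow_one]
    exact le_trans (mod_cast Finset.card_image_le) hX
  · have hpP : L.round p ∈ P := by
      rw [← Finset.mem_coe, hP]
      exact Set.mem_image_of_mem _ hp
    obtain ⟨x, hx, _, hw, hxw⟩ := Finset.mem_add.1 (hPX hpP)
    obtain ⟨u, hu, v, hv, rfl⟩ := Finset.mem_sub.1 hw
    rw [← Finset.mem_coe, hA'] at hu hv
    obtain ⟨a, ha, rfl⟩ := hu
    obtain ⟨b, hb, rfl⟩ := hv
    refine ⟨L.toHom x + (a - b), Set.add_mem_add ?_ ?_, p - (L.toHom x + (a - b)), ?_,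
      add_sub_cancel _ _⟩
    · exact_mod_cast Finset.mem_image_of_mem _ hx
    · rw [one_nsmul]
      exact Set.sub_mem_sub ha hb
    · have key : p - (L.toHom x + (a - b)) =
          (p - L.toHom (L.round p)) - ((a - L.toHom (L.round a)) - (b - L.toHom (L.round b))) := by
        rw [← hxw, map_add, map_sub]; abel
      have h1 := map_sub_le_add nm (p - L.toHom (L.round p))
        ((a - L.toHom (L.round a)) - (b - L.toHom (L.round b)))
      have h2 := map_sub_le_add nm (a - L.toHom (L.round a)) (b - L.toHom (L.round b))
      have h3 := L.seminorm_sub_le p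
      have h4 := L.seminorm_sub_le a
      have h5 := L.seminorm_sub_le b
      rw [mem_SBall_zero, key, pow_one]
      nlinarith

end LatticeRounding

/-- **Lemma 2.7** ("small sumset and `A + A·A` implies small `⟨A⟩_s`").
Here `GenSet A s = ⟨A⟩_{s+1}`, so quantifying over all `s : ℕ` expresses the claim for
every positive integer `s`. -/
theorem small_AplusA_and_AplusAA_implies_small_generated_sets
    {E : Type*} [Ring E] [Algebra ℝ E] [FiniteDimensional ℝ E]
    (nm : Seminorm ℝ E) (hnm : ∀ x : E, nm x = 0 → x = 0) (s : ℕ) :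
    ∃ K : ℝ, 1 ≤ K ∧ ∃ C : ℝ, 1 ≤ C ∧
      ∀ δ : ℝ, 0 < δ → ∀ ρ : ℝ, 0 < ρ → ρ ≤ 1 / 2 →
        ∀ A : Set E,
          A ⊆ SBall nm 0 ρ⁻¹ →
          (SCov nm δ (A + A) : ℝ) + (SCov nm δ (A + A * A) : ℝ) ≤ ρ⁻¹ * (SCov nm δ A : ℝ) →
          (SCov nm δ (GenSet A s) : ℝ) ≤ K * ρ ^ (-C) * (SCov nm δ A : ℝ) := by
  classical
  obtain ⟨M, hM0, hM⟩ := exists_seminorm_mul_le nm hnm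
  obtain ⟨n, c, hc, hL⟩ := exists_latticeRounding nm hnm
  obtain ⟨m, hm⟩ := ProductControlled.exists_genSet_covered nm s
  set κ : ℝ := (c * 5) ^ n with hκ
  have hκ1 : 1 ≤ κ := one_le_pow₀ (by linarith)
  have hc4 : (c * (1 + 3)) ^ n ≤ κ := by rw [hκ]; gcongr; norm_num
  have hc5 : (c * (2 + 3)) ^ n = κ := by rw [hκ]; norm_num
  set ℓ : ℝ := 3 + M + κ with hℓ
  have hℓ1 : 1 ≤ ℓ := by linarith
  set p : ℕ := m + 2 * m + m * n with hp
  refine ⟨κ * (c * (2 * m + 4)) ^ n * ℓ ^ p, ?_, (p : ℝ) + 1, by simp,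
    fun δ hδ ρ hρ hρ2 A hAρ hA ↦ ?_⟩
  · have h1 : 1 ≤ (c * (2 * m + 4)) ^ n := one_le_pow₀ (by nlinarith [m.cast_nonneg (α := ℝ)])
    exact one_le_mul_of_one_le_of_one_le (one_le_mul_of_one_le_of_one_le hκ1 h1) (one_le_pow₀ hℓ1)
  rcases A.eq_empty_or_nonempty with rfl | hne
  · rw [genSet_empty, Nat.le_zero.1 (SCov_le_card (nm := nm) (δ := δ) (F := ∅)
      (Set.empty_subset _))]
    simp
  obtain ⟨L⟩ := hL δ hδ
  have hr1 : 1 ≤ ρ⁻¹ := (one_le_inv₀ hρ).2 (by linarith)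
  have hAr : ∀ a ∈ A, nm a ≤ ρ⁻¹ := fun a ha ↦ mem_SBall_zero.1 (hAρ ha)
  have hAAr : ∀ x ∈ A * A, nm x ≤ M * ρ⁻¹ * ρ⁻¹ := by
    rintro _ ⟨a, ha, b, hb, rfl⟩
    refine (hM a b).trans ?_
    gcongr
    exacts [hAr a ha, hAr b hb]
  have hsum : ∀ x ∈ A + A, nm x ≤ ρ⁻¹ + ρ⁻¹ := by
    rintro _ ⟨a, ha, b, hb, rfl⟩
    exact (map_add_le_add nm a b).trans (add_le_add (hAr a ha) (hAr b hb))
  have hsumprod : ∀ x ∈ A + A * A, nm x ≤ ρ⁻¹ + M * ρ⁻¹ * ρ⁻¹ := by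
    rintro _ ⟨a, ha, b, hb, rfl⟩
    exact (map_add_le_add nm a b).trans (add_le_add (hAr a ha) (hAAr b hb))
  have hfin : ∀ {S : Set E} {R : ℝ}, (∀ x ∈ S, nm x ≤ R) → (L.round '' S).Finite := fun hS ↦ by
    obtain ⟨Z, -, hZ⟩ := L.exists_finset_of_near hδ hS zero_le_one
    refine Z.finite_toSet.subset ?_
    rintro _ ⟨x, hx, rfl⟩
    exact hZ x hx _ (by simpa using L.seminorm_sub_le x)
  obtain ⟨A', hA'⟩ := (hfin hAr).exists_finset_coe
  obtain ⟨P, hP⟩ := (hfin hAAr).exists_finset_coe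
  obtain ⟨Z₁, hZ₁, hZ₁'⟩ := L.exists_finset_of_near hδ hAr zero_le_one
  obtain ⟨Z₂, hZ₂, hZ₂'⟩ := L.exists_finset_of_near hδ hsum zero_le_two
  obtain ⟨Z₃, hZ₃, hZ₃'⟩ := L.exists_finset_of_near hδ hsumprod zero_le_two
  have hround : ∀ a ∈ A, L.round a ∈ A' := fun a ha ↦ by
    rw [← Finset.mem_coe, hA']
    exact Set.mem_image_of_mem _ ha
  have hA'ne : A'.Nonempty := let ⟨a, ha⟩ := hne; ⟨L.round a, hround a ha⟩
  have hnear : ∀ x y, nm (x + y - L.toHom (L.round x + L.round y)) ≤ 2 * δ := fun x y ↦ by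
    rw [map_add, add_sub_add_comm, two_mul]
    exact (map_add_le_add nm _ _).trans (add_le_add (L.seminorm_sub_le x) (L.seminorm_sub_le y))
  have hA'Z₁ : A' ⊆ Z₁ := fun z hz ↦ by
    rw [← Finset.mem_coe, hA'] at hz
    obtain ⟨a, ha, rfl⟩ := hz
    exact hZ₁' a ha _ (by simpa using L.seminorm_sub_le a)
  have hA'Z₂ : A' + A' ⊆ Z₂ := by
    rintro _ hz
    obtain ⟨u, hu, v, hv, rfl⟩ := Finset.mem_add.1 hz
    rw [← Finset.mem_coe, hA'] at hu hv
    obtain ⟨a, ha, rfl⟩ := hu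
    obtain ⟨b, hb, rfl⟩ := hv
    exact hZ₂' _ (Set.add_mem_add ha hb) _ (hnear a b)
  have hPZ₃ : P + A' ⊆ Z₃ := by
    rintro _ hz
    obtain ⟨u, hu, v, hv, rfl⟩ := Finset.mem_add.1 hz
    rw [← Finset.mem_coe, hP] at hu
    rw [← Finset.mem_coe, hA'] at hv
    obtain ⟨b, hb, rfl⟩ := hu
    obtain ⟨a, ha, rfl⟩ := hv
    rw [add_comm]
    exact hZ₃' _ (Set.add_mem_add ha hb) _ (hnear a b)
  have hcovA : (SCov nm δ A : ℝ) ≤ A'.card := mod_cast L.SCov_le_card hround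
  rw [hc5] at hZ₂ hZ₃
  set T : ℝ := ℓ * ρ⁻¹ with hT
  have hℓT : ℓ ≤ T := le_mul_of_one_le_right (by linarith) hr1
  have hT0 : 0 ≤ T := by linarith
  have hbound : ∀ {N k : ℝ}, N ≤ κ * k → k ≤ ρ⁻¹ * SCov nm δ A → N ≤ T * A'.card :=
    fun {N k} hN hk ↦ calc
      N ≤ κ * (ρ⁻¹ * A'.card) := hN.trans (by gcongr; exact hk.trans (by gcongr))
      _ ≤ ℓ * (ρ⁻¹ * A'.card) := by gcongr; linarith
      _ = T * A'.card := by rw [hT, mul_assoc]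
  have hZ₂T : (Z₂.card : ℝ) ≤ T * A'.card :=
    hbound hZ₂ (le_trans (le_add_of_nonneg_right (Nat.cast_nonneg _)) hA)
  have hZ₃T : (Z₃.card : ℝ) ≤ T * A'.card :=
    hbound hZ₃ (le_trans (le_add_of_nonneg_left (Nat.cast_nonneg _)) hA)
  have hcontrolled : ProductControlled nm T δ A :=
    { two_le := by linarith
      scale_nonneg := hδ.le
      nonempty := hne
      mul_le := fun x y ↦ (hM x y).trans (mul_le_mul_of_nonneg_right
        (mul_le_mul_of_nonneg_right (by linarith) (apply_nonneg nm x)) (apply_nonneg nm y))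
      norm_le := fun a ha ↦ (hAr a ha).trans (le_mul_of_one_le_left (by linarith) hℓ1)
      mul_covered := L.translateCovered_mul (by linarith) hδ.le hA'ne hA' hP hPZ₃ hZ₃T }
  have hdiff := card_nsmul_sub_le hA'ne ((Nat.cast_le.2 (Finset.card_le_card hA'Z₂)).trans hZ₂T) m
  have hcardA' : (A'.card : ℝ) ≤ κ * SCov nm δ A :=
    (Nat.cast_le.2 (Finset.card_le_card hA'Z₁)).trans (hZ₁.trans (by gcongr))
  have hTm : 1 ≤ T ^ m := one_le_pow₀ (by linarith)
  have hρp : ρ⁻¹ ^ p ≤ ρ ^ (-((p : ℝ) + 1)) := by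
    rw [Real.rpow_neg hρ.le, ← Nat.cast_add_one, Real.rpow_natCast, ← inv_pow]
    exact pow_le_pow_right₀ hr1 (Nat.le_succ p)
  calc (SCov nm δ (GenSet A s) : ℝ)
      ≤ T ^ m * (m • (A' - A')).card * (c * (2 * m + T ^ m + 3)) ^ n :=
        L.SCov_le_of_translateCovered hT0 hround (hm T δ A hcontrolled)
    _ ≤ T ^ m * (T ^ (2 * m) * (κ * SCov nm δ A)) * (c * ((2 * m + 4) * T ^ m)) ^ n := by
        gcongr
        · exact hdiff.trans (by gcongr)
        · nlinarith [mul_le_mul_of_nonneg_left hTm (by positivity : (0 : ℝ) ≤ 2 * m)]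
    _ = κ * (c * (2 * m + 4)) ^ n * T ^ p * SCov nm δ A := by
        have hpow : (c * ((2 * m + 4) * T ^ m)) ^ n = (c * (2 * m + 4)) ^ n * T ^ (m * n) := by
          rw [pow_mul, ← mul_pow, mul_assoc]
        rw [hp, hpow, pow_add, pow_add]
        ring
    _ = κ * (c * (2 * m + 4)) ^ n * ℓ ^ p * ρ⁻¹ ^ p * SCov nm δ A := by
        rw [hT, mul_pow ℓ, ← mul_assoc]
    _ ≤ κ * (c * (2 * m + 4)) ^ n * ℓ ^ p * ρ ^ (-((p : ℝ) + 1)) * SCov nm δ A := by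
        gcongr
end

section
/- Let E be a finite-dimensional normed real algebra. There exist constants C ≥ 1 and c > 0 depending only on E such that for every 0 < ρ ≤ 1/2 and every subset A ⊆ B(0, ρ^{-1}) of E that is ρ-away from subalgebras, there exists a subset A' ⊆ A of cardinality at most dim_ℝ E such that A' is cρ^C-away from subalgebras. -/
open Pointwise

open Filter Polynomial

section CoefficientField

theorem ValuationSubring.valuation_mul_sub_mul_lt_one {F : Type*} [Field F]
    (R : ValuationSubring F) {x y s t : F} (hs : s ∈ R) (ht : t ∈ R)
    (hx : R.valuation (x - s) < 1) (hy : R.valuation (y - t) < 1) :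
    R.valuation (x * y - s * t) < 1 := by
  have hxR : x ∈ R := by
    have := R.add_mem _ _ ((R.valuation_le_one_iff _).1 hx.le) hs
    rwa [sub_add_cancel] at this
  rw [show x * y - s * t = x * (y - t) + t * (x - s) by ring]
  refine R.valuation.map_add_lt ?_ ?_ <;> rw [map_mul]
  · exact mul_lt_one_of_nonneg_of_lt_one_right ((R.valuation_le_one_iff _).2 hxR) zero_le hy
  · exact mul_lt_one_of_nonneg_of_lt_one_right ((R.valuation_le_one_iff _).2 ht) zero_le hx

theorem IntermediateField.eq_zero_of_valuation_lt_one {k F : Type*} [Field k] [Field F]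
    [Algebra k F]
    {K : IntermediateField k F} {R : ValuationSubring F}
    (hKR : ∀ x ∈ K, x ∈ R) {x : F} (hx : x ∈ K) (h : R.valuation x < 1) : x = 0 := by
  by_contra h0
  have h1 : R.valuation x⁻¹ ≤ 1 := (R.valuation_le_one_iff _).2 (hKR _ (K.inv_mem hx))
  have h2 : R.valuation x * R.valuation x⁻¹ = 1 := by
    rw [← map_mul, mul_inv_cancel₀ h0, map_one]
  exact absurd h2 (mul_lt_one_of_nonneg_of_lt_one_left zero_le h h1).ne

variable {k F : Type*} [Field k] [Field F] [LinearOrder F] [IsStrictOrderedRing F]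

/-- Hensel's lemma for convex valuation rings, from the intermediate value property. -/
theorem ValuationSubring.exists_root_of_intermediateValue (R : ValuationSubring F)
    (hR : ∀ x y : F, |x| ≤ |y| → R.valuation x ≤ R.valuation y)
    (hF : ∀ (p : F[X]) (a h : F), p.eval (a - h) * p.eval (a + h) ≤ 0 →
      ∃ c, |c - a| ≤ |h| ∧ p.eval c = 0)
    (q : R[X]) (a : R) (h0 : R.valuation (q.eval a : R) < 1)
    (h1 : R.valuation (q.derivative.eval a : R) = 1) :
    ∃ b : R, q.eval b = 0 ∧ R.valuation ((b : F) - a) < 1 := by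
  have abs_lt_one : ∀ x : F, R.valuation x < 1 → |x| < 1 := by
    intro x hx
    by_contra! h
    have := hR 1 x (by simpa using h)
    simp only [map_one] at this
    exact absurd hx (not_lt.2 this)
  obtain ⟨e, he⟩ : ∃ e : R, e = q.eval a := ⟨_, rfl⟩
  obtain ⟨d, hd⟩ : ∃ d : R, d = q.derivative.eval a := ⟨_, rfl⟩
  rw [← he] at h0
  rw [← hd] at h1
  have hd0 : (d : F) ≠ 0 := by
    intro h; simp [h] at h1
  have hdinv : (d : F)⁻¹ ∈ R := by
    rw [← R.valuation_le_one_iff, map_inv₀, h1]; simp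
  obtain ⟨u, hu⟩ : ∃ u : R, (u : F) = (d : F)⁻¹ := ⟨⟨_, hdinv⟩, rfl⟩
  have hdu : d * u = 1 := by
    apply Subtype.ext; simp [hu, hd0]
  have small_mul : ∀ t : R, R.valuation ((t * e : R) : F) < 1 := by
    intro t
    push_cast
    rw [map_mul]
    exact mul_lt_one_of_nonneg_of_lt_one_right (R.valuation_le_one t) zero_le h0
  obtain ⟨s, hs⟩ := q.binomExpansion a (4 * e * u)
  obtain ⟨t, ht⟩ := q.binomExpansion a (-(4 * e * u))
  have hs' : q.eval (a + 4 * e * u) = e * (5 + s * 16 * u ^ 2 * e) := by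
    rw [hs, ← he, ← hd]; linear_combination (4 * e) * hdu
  have ht' : q.eval (a + -(4 * e * u)) = e * (-3 + t * 16 * u ^ 2 * e) := by
    rw [ht, ← he, ← hd]; linear_combination (-4 * e) * hdu
  have hS := abs_lt.1 (abs_lt_one _ (small_mul (s * 16 * u ^ 2)))
  have hT := abs_lt.1 (abs_lt_one _ (small_mul (t * 16 * u ^ 2)))
  have cast_eval : ∀ x : R, (q.map R.subtype).eval (x : F) = ((q.eval x : R) : F) := by
    intro x
    exact Polynomial.eval_map_apply (f := R.subtype) (p := q) x
  obtain ⟨c, hc, hc0⟩ := hF (q.map R.subtype) a ((4 * e * u : R) : F) (by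
    have e1 : (a : F) - ((4 * e * u : R) : F) = ((a + -(4 * e * u) : R) : F) := by
      push_cast; ring
    have e2 : (a : F) + ((4 * e * u : R) : F) = ((a + (4 * e * u) : R) : F) := by
      push_cast; ring
    rw [e1, e2, cast_eval, cast_eval, hs', ht']
    generalize (s * 16 * u ^ 2 * e) = S at *
    generalize (t * 16 * u ^ 2 * e) = T at *
    have : (((e * (-3 + T) : R) : F)) * ((e * (5 + S) : R) : F) =
        -((e : F) ^ 2 * ((3 - T) * (5 + S))) := by
      have h3 : ((3 : R) : F) = 3 := map_ofNat R.subtype 3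
      have h5 : ((5 : R) : F) = 5 := map_ofNat R.subtype 5
      push_cast [h3, h5]; ring
    rw [this]
    have : 0 ≤ (e : F) ^ 2 * ((3 - T) * (5 + S)) :=
      mul_nonneg (sq_nonneg _) (mul_nonneg (by linarith [hT.2]) (by linarith [hS.1]))
    linarith)
  have hca : R.valuation (c - a) < 1 := by
    refine (hR _ _ hc).trans_lt ?_
    have := small_mul (4 * u)
    rwa [show 4 * u * e = 4 * e * u by ring] at this
  have hcR : c ∈ R := by
    have : c = (c - a) + a := by ring
    rw [this]
    exact R.add_mem _ _ ((R.valuation_le_one_iff _).1 hca.le) a.2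
  refine ⟨⟨c, hcR⟩, ?_, hca⟩
  apply Subtype.ext
  rw [← cast_eval]
  exact hc0

/-- A convex valuation ring in an ordered field with the intermediate value property for
polynomials has a field of representatives. -/
theorem ValuationSubring.exists_coefficient_field [Algebra k F] (R : ValuationSubring F)
    (hk : ∀ x : k, algebraMap k F x ∈ R)
    (hR : ∀ x y : F, |x| ≤ |y| → R.valuation x ≤ R.valuation y)
    (hF : ∀ (p : F[X]) (a h : F), p.eval (a - h) * p.eval (a + h) ≤ 0 →
      ∃ c, |c - a| ≤ |h| ∧ p.eval c = 0) :
    ∃ K : IntermediateField k F, (∀ x ∈ K, x ∈ R) ∧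
      ∀ x ∈ R, ∃ y ∈ K, R.valuation (x - y) < 1 := by
  obtain ⟨K, hK⟩ : ∃ K : IntermediateField k F, Maximal (fun K => ∀ x ∈ K, x ∈ R) K := by
    obtain ⟨K, -, hK⟩ := zorn_le_nonempty₀ {K : IntermediateField k F | ∀ x ∈ K, x ∈ R} (by
      intro c hc hchain y hy
      have : Nonempty c := ⟨⟨y, hy⟩⟩
      refine ⟨sSup c, ?_, fun z hz => le_sSup hz⟩
      intro x hx
      rw [sSup_eq_iSup', ← SetLike.mem_coe,
        IntermediateField.coe_iSup_of_directed hchain.directed] at hx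
      obtain ⟨i, hi⟩ := Set.mem_iUnion.1 hx
      exact hc i.2 x hi) ⊥ (by
        intro x hx
        obtain ⟨y, rfl⟩ := IntermediateField.mem_bot.1 hx
        exact hk y)
    exact ⟨K, hK⟩
  have hKR := hK.prop
  refine ⟨K, hKR, fun a ha => ?_⟩
  have mem_of_adjoin : ∀ b : F, (∀ x ∈ IntermediateField.adjoin K {b}, x ∈ R) → b ∈ K := by
    intro b hb
    have hle : K ≤ (IntermediateField.adjoin K {b}).restrictScalars k := by
      intro x hx
      exact (IntermediateField.adjoin K {b}).algebraMap_mem ⟨x, hx⟩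
    exact hK.le_of_ge (y := (IntermediateField.adjoin K {b}).restrictScalars k) hb hle
      (IntermediateField.mem_adjoin_simple_self K b)
  let ι : K →+* R :=
    { toFun := fun x => ⟨x, hKR x x.2⟩
      map_one' := rfl
      map_mul' := fun _ _ => rfl
      map_zero' := rfl
      map_add' := fun _ _ => rfl }
  have aeval_eq : ∀ (p : K[X]) (b : R), aeval (b : F) p = (((p.map ι).eval b : R) : F) := by
    intro p b
    have : algebraMap K F = R.subtype.comp ι := rfl
    rw [aeval_def, this, ← eval₂_map]
    exact eval₂_hom (p := p.map ι) R.subtype b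
  by_cases htr : ∀ p : K[X], p ≠ 0 → R.valuation (aeval a p) = 1
  · refine ⟨a, mem_of_adjoin a ?_, by simp⟩
    intro x hx
    obtain ⟨r, s, rfl⟩ := (IntermediateField.mem_adjoin_simple_iff K x).1 hx
    rw [← R.valuation_le_one_iff, map_div₀]
    by_cases hs : s = 0
    · simp [hs]
    · rw [htr s hs, div_one, aeval_eq r ⟨a, ha⟩]
      exact R.valuation_le_one _
  · have hex : ∃ n : ℕ, ∃ p : K[X], p.natDegree = n ∧ p ≠ 0 ∧ R.valuation (aeval a p) < 1 := by
      push Not at htr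
      obtain ⟨p, hp, hpa⟩ := htr
      refine ⟨_, p, rfl, hp, lt_of_le_of_ne ?_ hpa⟩
      rw [aeval_eq p ⟨a, ha⟩]
      exact R.valuation_le_one _
    classical
    obtain ⟨p, hpn, hp0, hpa⟩ := Nat.find_spec hex
    have hdeg : p.natDegree ≠ 0 := by
      intro h
      rw [natDegree_eq_zero] at h
      obtain ⟨c, rfl⟩ := h
      have hc : c ≠ 0 := by rintro rfl; simp at hp0
      have hc1 : R.valuation ((c : F)⁻¹) ≤ 1 :=
        (R.valuation_le_one_iff _).2 (hKR _ (c⁻¹).2)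
      rw [aeval_C] at hpa
      change R.valuation (c : F) < 1 at hpa
      have hc' : (c : F) ≠ 0 := by simpa using hc
      have : R.valuation (c : F) * R.valuation ((c : F)⁻¹) = 1 := by
        rw [← map_mul, mul_inv_cancel₀ hc', map_one]
      exact absurd this (mul_lt_one_of_nonneg_of_lt_one_left zero_le hpa hc1).ne
    have hder : R.valuation (aeval a (derivative p)) = 1 := by
      by_contra hne
      have hlt : R.valuation (aeval a (derivative p)) < 1 := by
        refine lt_of_le_of_ne ?_ hne
        rw [aeval_eq _ ⟨a, ha⟩]
        exact R.valuation_le_one _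
      have : CharZero K := (algebraMap K F).charZero
      refine Nat.find_min hex (m := (derivative p).natDegree) ?_ ⟨_, rfl, ?_, hlt⟩
      · rw [← hpn]; exact natDegree_derivative_lt hdeg
      · intro h
        exact hdeg (derivative_eq_zero.1 h)
    obtain ⟨b, hb0, hba⟩ := R.exists_root_of_intermediateValue hR hF (p.map ι) ⟨a, ha⟩
      (by rw [← aeval_eq]; exact hpa) (by rw [derivative_map, ← aeval_eq]; exact hder)
    have halg : IsAlgebraic K (b : F) := ⟨p, hp0, by rw [aeval_eq, hb0]; rfl⟩
    refine ⟨b, mem_of_adjoin b ?_, ?_⟩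
    · intro x hx
      rw [← IntermediateField.mem_toSubalgebra,
        IntermediateField.adjoin_simple_toSubalgebra_of_isAlgebraic halg,
        Algebra.adjoin_singleton_eq_range_aeval] at hx
      obtain ⟨r, rfl⟩ := hx
      change aeval (b : F) r ∈ R
      rw [aeval_eq]
      exact SetLike.coe_mem _
    · rwa [← Valuation.map_neg, neg_sub]

end CoefficientField

section ModerateSubring

variable {F : Type*} [Field F] [LinearOrder F] [IsStrictOrderedRing F]

/-- The valuation ring of elements bounded by some power of `τ`. -/
def moderateSubring (τ : F) (hτ : 2 ≤ τ) : ValuationSubring F where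
  carrier := {x | ∃ k : ℕ, |x| ≤ τ ^ k}
  mul_mem' := by
    rintro x y ⟨k, hk⟩ ⟨l, hl⟩
    exact ⟨k + l, by rw [abs_mul, pow_add]; gcongr⟩
  one_mem' := ⟨0, by simp⟩
  add_mem' := by
    rintro x y ⟨k, hk⟩ ⟨l, hl⟩
    have h1 : 1 ≤ τ := by linarith
    refine ⟨max k l + 1, (abs_add_le x y).trans ?_⟩
    have hk' := hk.trans (pow_le_pow_right₀ h1 (le_max_left k l))
    have hl' := hl.trans (pow_le_pow_right₀ h1 (le_max_right k l))
    have h0 : 0 ≤ τ ^ max k l := by positivity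
    rw [pow_succ]
    nlinarith
  zero_mem' := ⟨0, by simp⟩
  neg_mem' := by
    rintro x ⟨k, hk⟩
    exact ⟨k, by rwa [abs_neg]⟩
  mem_or_inv_mem' := by
    intro x
    rcases le_total |x| 1 with h | h
    · exact Or.inl ⟨0, by simpa using h⟩
    · exact Or.inr ⟨0, by simpa [abs_inv] using inv_le_one_of_one_le₀ h⟩

variable {τ : F} {hτ : 2 ≤ τ}

theorem mem_moderateSubring {x : F} : x ∈ moderateSubring τ hτ ↔ ∃ k : ℕ, |x| ≤ τ ^ k := Iff.rfl

theorem mem_moderateSubring_of_abs_le {x y : F} (h : |x| ≤ y) (hy : y ∈ moderateSubring τ hτ) :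
    x ∈ moderateSubring τ hτ := by
  obtain ⟨k, hk⟩ := hy
  exact ⟨k, h.trans ((le_abs_self y).trans hk)⟩

theorem moderateSubring_valuation_le_of_abs_le {x y : F} (h : |x| ≤ |y|) :
    (moderateSubring τ hτ).valuation x ≤ (moderateSubring τ hτ).valuation y := by
  rcases eq_or_ne y 0 with rfl | hy
  · have : x = 0 := by simpa using h
    rw [this]
  · have hxy : x / y ∈ moderateSubring τ hτ :=
      ⟨0, by rw [abs_div, pow_zero]; exact div_le_one_of_le₀ h (abs_nonneg y)⟩
    rw [← ValuationSubring.valuation_le_one_iff] at hxy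
    calc _ = (moderateSubring τ hτ).valuation (x / y) * (moderateSubring τ hτ).valuation y := by
          rw [← map_mul, div_mul_cancel₀ x hy]
      _ ≤ 1 * (moderateSubring τ hτ).valuation y := by gcongr
      _ = _ := one_mul _

theorem moderateSubring_valuation_abs (x : F) :
    (moderateSubring τ hτ).valuation |x| = (moderateSubring τ hτ).valuation x :=
  le_antisymm (moderateSubring_valuation_le_of_abs_le (abs_abs x).le)
    (moderateSubring_valuation_le_of_abs_le (abs_abs x).ge)

theorem moderateSubring_valuation_lt_one {x : F} (h : ∀ k : ℕ, |x| < (τ⁻¹) ^ k) :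
    (moderateSubring τ hτ).valuation x < 1 := by
  by_contra! hx
  have hx0 : x ≠ 0 := by rintro rfl; simp at hx
  have : x⁻¹ ∈ moderateSubring τ hτ := by
    rw [← ValuationSubring.valuation_le_one_iff, map_inv₀]
    exact inv_le_one_of_one_le₀ hx
  obtain ⟨k, hk⟩ := this
  have := h k
  rw [abs_inv] at hk
  rw [inv_pow] at this
  have h2 := (inv_le_comm₀ (abs_pos.2 hx0) (by positivity)).1 hk
  exact absurd this (not_lt.2 h2)

theorem moderateSubring_valuation_self : (moderateSubring τ hτ).valuation τ = 1 := by
  refine le_antisymm ?_ ?_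
  · rw [ValuationSubring.valuation_le_one_iff]
    exact ⟨1, by rw [abs_of_nonneg (by linarith), pow_one]⟩
  · rw [← map_one (moderateSubring τ hτ).valuation]
    exact moderateSubring_valuation_le_of_abs_le
      (by rw [abs_one, abs_of_nonneg (by linarith)]; linarith)

end ModerateSubring

section RealGerm

/-- Germs of real sequences along a nonprincipal ultrafilter. -/
abbrev RealGerm : Type := Germ (hyperfilter ℕ : Filter ℕ) ℝ

noncomputable instance : Algebra ℝ RealGerm :=
  Algebra.ofModule (by
    intro r x y
    induction x using Germ.inductionOn
    induction y using Germ.inductionOn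
    exact congrArg _ (funext fun n => mul_assoc r _ _))
    (by
    intro r x y
    induction x using Germ.inductionOn
    induction y using Germ.inductionOn
    exact congrArg _ (funext fun n => mul_left_comm _ r _))

theorem RealGerm.algebraMap_apply (r : ℝ) :
    algebraMap ℝ RealGerm r = ((fun _ => r : ℕ → ℝ) : RealGerm) := by
  rw [Algebra.algebraMap_eq_smul_one]
  exact congrArg _ (funext fun n => mul_one r)

theorem RealGerm.coe_sum {ι : Type*} (s : Finset ι) (f : ι → ℕ → ℝ) :
    ((fun n => ∑ i ∈ s, f i n : ℕ → ℝ) : RealGerm) = ∑ i ∈ s, (f i : RealGerm) := by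
  have := map_sum (Germ.coeRingHom (R := ℝ) (hyperfilter ℕ : Filter ℕ)) f s
  rw [← show (∑ i ∈ s, f i) = (fun n => ∑ i ∈ s, f i n) from
    funext fun n => Finset.sum_apply n s f]
  exact this

theorem RealGerm.abs_coe (f : ℕ → ℝ) : |(f : RealGerm)| = ((fun n => |f n| : ℕ → ℝ) : RealGerm) :=
  Germ.abs_def _

theorem RealGerm.intermediateValue (p : RealGerm[X]) (a h : RealGerm)
    (hp : p.eval (a - h) * p.eval (a + h) ≤ 0) : ∃ c, |c - a| ≤ |h| ∧ p.eval c = 0 := by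
  have hrep : ∀ x : RealGerm, ∃ f : ℕ → ℝ, (f : RealGerm) = x := fun x =>
    Germ.inductionOn x fun f => ⟨f, rfl⟩
  choose g hg using hrep
  let P : ℕ → ℝ[X] := fun n => ∑ i ∈ Finset.range (p.natDegree + 1), C (g (p.coeff i) n) * X ^ i
  have eval_coe : ∀ f : ℕ → ℝ, p.eval (f : RealGerm) =
      ((fun n => (P n).eval (f n) : ℕ → ℝ) : RealGerm) := by
    intro f
    simp only [P, eval_finsetSum, eval_mul, eval_C, eval_pow, eval_X]
    rw [RealGerm.coe_sum, eval_eq_sum_range]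
    refine Finset.sum_congr rfl fun i _ => ?_
    conv_lhs => rw [← hg (p.coeff i)]
    rfl
  obtain ⟨a, rfl⟩ : ∃ f : ℕ → ℝ, (f : RealGerm) = a := ⟨_, hg a⟩
  obtain ⟨h, rfl⟩ : ∃ f : ℕ → ℝ, (f : RealGerm) = h := ⟨_, hg h⟩
  rw [← Germ.coe_sub, ← Germ.coe_add, eval_coe, eval_coe, ← Germ.coe_mul, ← Germ.coe_zero,
    Germ.coe_le] at hp
  have key : ∀ᶠ n in (hyperfilter ℕ : Filter ℕ),
      ∃ c, |c - a n| ≤ |h n| ∧ (P n).eval c = 0 := by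
    filter_upwards [hp] with n hn
    have hcont : ContinuousOn (fun x => (P n).eval x) (Set.uIcc (a n - h n) (a n + h n)) :=
      (P n).continuous.continuousOn
    have h0 : (0 : ℝ) ∈ Set.uIcc ((P n).eval (a n - h n)) ((P n).eval (a n + h n)) := by
      rw [Set.mem_uIcc]
      simp only [Pi.mul_apply, Pi.sub_apply, Pi.add_apply, Pi.zero_apply] at hn
      rcases mul_nonpos_iff.1 hn with h | h
      · exact Or.inr ⟨h.2, h.1⟩
      · exact Or.inl h
    obtain ⟨c, hc, hc0⟩ := intermediate_value_uIcc hcont h0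
    refine ⟨c, ?_, hc0⟩
    rw [Set.mem_uIcc] at hc
    rw [abs_le]
    rcases hc with hc | hc
    · have := le_abs_self (h n)
      constructor <;> linarith
    · have := neg_le_abs (h n)
      constructor <;> linarith
  obtain ⟨c, hc⟩ := key.choice
  refine ⟨(c : RealGerm), ?_, ?_⟩
  · rw [← Germ.coe_sub, RealGerm.abs_coe, RealGerm.abs_coe, Germ.coe_le]
    exact hc.mono fun n hn => hn.1
  · rw [eval_coe, ← Germ.coe_zero, Germ.coe_eq]
    exact hc.mono fun n hn => hn.2

end RealGerm

section ExtensionOfScalars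

open scoped TensorProduct

theorem Module.Basis.repr_mul {A B ι : Type*} [CommRing A] [Ring B] [Algebra A B] [Fintype ι]
    (b : Module.Basis ι A B) (x y : B) (i : ι) :
    b.repr (x * y) i = ∑ j, ∑ l, b.repr x j * b.repr y l * b.repr (b j * b l) i := by
  conv_lhs => rw [← b.sum_repr x, ← b.sum_repr y, Finset.sum_mul_sum]
  simp only [smul_mul_smul_comm, map_sum, map_smul, Finsupp.finsetSum_apply, Finsupp.smul_apply,
    smul_eq_mul]

theorem Subalgebra.exists_spanning_family_of_ne_top {k K E : Type*} [Field k] [Field K]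
    [Algebra k K] [Ring E] [Algebra k E] [FiniteDimensional k E]
    {W : Subalgebra K (K ⊗[k] E)} (hW : W ≠ ⊤) :
    ∃ r < Module.finrank k E, ∃ w : Fin r → K ⊗[k] E, (∀ j, w j ∈ W) ∧
      ∀ t ∈ W, ∃ c : Fin r → K, t = ∑ j, c j • w j := by
  let w := Module.finBasis K (Subalgebra.toSubmodule W)
  have hlt := Submodule.finrank_lt (s := Subalgebra.toSubmodule W) (by simpa using hW)
  rw [Module.finrank_baseChange] at hlt
  refine ⟨_, hlt, fun j => w j, fun j => (w j).2, fun t ht => ⟨w.repr ⟨t, ht⟩, ?_⟩⟩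
  have := congrArg Subtype.val (w.sum_repr ⟨t, ht⟩)
  rw [Submodule.coe_sum] at this
  exact this.symm

variable {E ι : Type*} [Ring E] [Algebra ℝ E] (b : Module.Basis ι ℝ E)

/-- The germ of the `i`-th coordinate of a sequence. -/
noncomputable def coordGerm (x : ℕ → E) (i : ι) : RealGerm :=
  ((fun n => b.repr (x n) i : ℕ → ℝ) : RealGerm)

theorem coordGerm_mul [Fintype ι] (x y : ℕ → E) (i : ι) :
    coordGerm b (fun n => x n * y n) i = ∑ j, ∑ l, coordGerm b x j * coordGerm b y l *
      algebraMap ℝ RealGerm (b.repr (b j * b l) i) := by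
  simp only [RealGerm.algebraMap_apply]
  rw [coordGerm, funext fun n => b.repr_mul (x n) (y n) i, RealGerm.coe_sum]
  refine Finset.sum_congr rfl fun j _ => ?_
  rw [RealGerm.coe_sum]
  rfl

theorem coordGerm_add (x y : ℕ → E) (i : ι) :
    coordGerm b (fun n => x n + y n) i = coordGerm b x i + coordGerm b y i := by
  simp only [coordGerm, map_add]
  rfl

theorem coordGerm_sub (x y : ℕ → E) (i : ι) :
    coordGerm b (fun n => x n - y n) i = coordGerm b x i - coordGerm b y i := by
  simp only [coordGerm, map_sub]
  rfl

theorem coordGerm_smul (c : ℕ → ℝ) (x : ℕ → E) (i : ι) :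
    coordGerm b (fun n => c n • x n) i = (c : RealGerm) * coordGerm b x i := by
  simp only [coordGerm, map_smul]
  rfl

theorem coordGerm_sum {κ : Type*} (s : Finset κ) (x : κ → ℕ → E) (i : ι) :
    coordGerm b (fun n => ∑ j ∈ s, x j n) i = ∑ j ∈ s, coordGerm b (x j) i := by
  simp only [coordGerm, map_sum, Finsupp.finsetSum_apply]
  exact RealGerm.coe_sum s _

theorem coordGerm_const (x : E) (i : ι) :
    coordGerm b (fun _ => x) i = algebraMap ℝ RealGerm (b.repr x i) := by
  rw [RealGerm.algebraMap_apply]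
  rfl

theorem coordGerm_eq_iff [Finite ι] {x y : ℕ → E} :
    (∀ i, coordGerm b x i = coordGerm b y i) ↔ x =ᶠ[(hyperfilter ℕ : Filter ℕ)] y := by
  simp only [coordGerm, Germ.coe_eq]
  constructor
  · intro h
    filter_upwards [eventually_all.2 h] with n hn
    exact b.ext_elem hn
  · intro h i
    filter_upwards [h] with n hn
    rw [hn]

variable (K : IntermediateField ℝ RealGerm)

/-- The `i`-th coordinate of a point of `K ⊗ E`, as a germ. -/
noncomputable def coordExt (t : K ⊗[ℝ] E) (i : ι) : RealGerm :=
  ((Algebra.TensorProduct.basis K b).repr t i : K)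

theorem coordExt_mem (t : K ⊗[ℝ] E) (i : ι) : coordExt b K t i ∈ K := SetLike.coe_mem _

theorem coordExt_tmul (k : K) (x : E) (i : ι) :
    coordExt b K (k ⊗ₜ x) i = k * algebraMap ℝ RealGerm (b.repr x i) := by
  simp only [coordExt, Algebra.TensorProduct.basis_repr_tmul]
  rfl

theorem coordExt_mul [Fintype ι] (s t : K ⊗[ℝ] E) (i : ι) :
    coordExt b K (s * t) i = ∑ j, ∑ l, coordExt b K s j * coordExt b K t l *
      algebraMap ℝ RealGerm (b.repr (b j * b l) i) := by
  simp only [coordExt, (Algebra.TensorProduct.basis K b).repr_mul s t,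
    Algebra.TensorProduct.basis_apply, Algebra.TensorProduct.tmul_mul_tmul, mul_one,
    Algebra.TensorProduct.basis_repr_tmul]
  push_cast
  simp

theorem coordExt_add (s t : K ⊗[ℝ] E) (i : ι) :
    coordExt b K (s + t) i = coordExt b K s i + coordExt b K t i := by
  simp [coordExt]

theorem coordExt_smul (k : K) (t : K ⊗[ℝ] E) (i : ι) :
    coordExt b K (k • t) i = k * coordExt b K t i := by
  simp [coordExt]

theorem coordExt_sum {κ : Type*} (s : Finset κ) (t : κ → K ⊗[ℝ] E) (i : ι) :
    coordExt b K (∑ j ∈ s, t j) i = ∑ j ∈ s, coordExt b K (t j) i := by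
  simp [coordExt, Finsupp.finsetSum_apply]

theorem exists_coordExt_eq [Fintype ι] (g : ι → RealGerm) (hg : ∀ i, g i ∈ K) :
    ∃ t : K ⊗[ℝ] E, ∀ i, coordExt b K t i = g i := by
  refine ⟨(Algebra.TensorProduct.basis K b).equivFun.symm fun i => ⟨g i, hg i⟩, fun i => ?_⟩
  have := congrFun ((Algebra.TensorProduct.basis K b).equivFun.apply_symm_apply
    fun i => ⟨g i, hg i⟩) i
  rw [Module.Basis.equivFun_apply] at this
  rw [coordExt, this]

theorem exists_coordGerm_eq [Fintype ι] (t : K ⊗[ℝ] E) :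
    ∃ x : ℕ → E, ∀ i, coordGerm b x i = coordExt b K t i := by
  have hrep : ∀ g : RealGerm, ∃ f : ℕ → ℝ, (f : RealGerm) = g := fun x =>
    Germ.inductionOn x fun f => ⟨f, rfl⟩
  choose f hf using fun i => hrep (coordExt b K t i)
  refine ⟨fun n => b.equivFun.symm fun i => f i n, fun i => ?_⟩
  rw [← hf, coordGerm]
  refine congrArg _ (funext fun n => ?_)
  exact congrFun (b.equivFun.apply_symm_apply fun i => f i n) i

/-- A proper `K`-subalgebra of `K ⊗ E` is represented by proper subalgebras of `E`. -/
theorem exists_subalgebra_sequence [Fintype ι] (W : Subalgebra K (K ⊗[ℝ] E)) (hW : W ≠ ⊤) :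
    ∃ V : ℕ → Subalgebra ℝ E, (∀ᶠ n in (hyperfilter ℕ : Filter ℕ), V n ≠ ⊤) ∧
      ∀ t ∈ W, ∀ y : ℕ → E, (∀ i, coordGerm b y i = coordExt b K t i) →
        ∀ᶠ n in (hyperfilter ℕ : Filter ℕ), y n ∈ V n := by
  have hfinE : FiniteDimensional ℝ E := b.finiteDimensional_of_finite
  obtain ⟨r, hr, w, hwW, hw⟩ := Subalgebra.exists_spanning_family_of_ne_top hW
  choose x hx using fun j => exists_coordGerm_eq b K (w j)
  have hspan : ∀ t ∈ W, ∀ y : ℕ → E, (∀ i, coordGerm b y i = coordExt b K t i) →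
      ∀ᶠ n in (hyperfilter ℕ : Filter ℕ), y n ∈ Submodule.span ℝ (Set.range fun j => x j n) := by
    intro t ht y hy
    have hrep : ∀ g : RealGerm, ∃ f : ℕ → ℝ, (f : RealGerm) = g := fun x =>
      Germ.inductionOn x fun f => ⟨f, rfl⟩
    obtain ⟨c, hsum⟩ := hw t ht
    choose f hf using fun j => hrep (c j : K)
    have heq : y =ᶠ[(hyperfilter ℕ : Filter ℕ)] fun n => ∑ j, f j n • x j n := by
      rw [← coordGerm_eq_iff b]
      intro i
      rw [hy, coordGerm_sum]
      conv_lhs => rw [hsum]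
      simp only [coordExt_sum, coordExt_smul, coordGerm_smul, hf, hx]
    filter_upwards [heq] with n hn
    rw [hn]
    exact Submodule.sum_mem _ fun j _ =>
      Submodule.smul_mem _ _ (Submodule.subset_span ⟨j, rfl⟩)
  have hone := hspan 1 W.one_mem (fun _ => 1) fun i => by
    rw [coordGerm_const, Algebra.TensorProduct.one_def, coordExt_tmul]
    simp
  have hmul := eventually_all.2 fun j => eventually_all.2 fun l =>
    hspan (w j * w l) (W.mul_mem (hwW j) (hwW l)) (fun n => x j n * x l n) fun i => by
      rw [coordGerm_mul, coordExt_mul]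
      simp only [hx]
  refine ⟨fun n => Algebra.adjoin ℝ (Set.range fun j => x j n), ?_, ?_⟩
  · filter_upwards [hone, hmul] with n hn1 hn2 htop
    have hle : Submodule.span ℝ (Set.range fun j => x j n) *
        Submodule.span ℝ (Set.range fun j => x j n) ≤
        Submodule.span ℝ (Set.range fun j => x j n) := by
      rw [Submodule.span_mul_span, Submodule.span_le]
      rintro _ ⟨_, ⟨j, rfl⟩, _, ⟨l, rfl⟩, rfl⟩
      exact hn2 j l
    have hadj : Algebra.adjoin ℝ (Set.range fun j => x j n) ≤
        (Submodule.span ℝ (Set.range fun j => x j n)).toSubalgebra hn1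
          (fun _ _ ha hb => hle (Submodule.mul_mem_mul ha hb)) :=
      Algebra.adjoin_le Submodule.subset_span
    have hspan_top : Submodule.span ℝ (Set.range fun j => x j n) = ⊤ := by
      rw [htop] at hadj
      exact top_le_iff.1 fun z _ => hadj (Algebra.mem_top (x := z))
    have h1 : Module.finrank ℝ E ≤ r := by
      rw [← finrank_top ℝ E, ← hspan_top]
      exact (finrank_range_le_card (R := ℝ) fun j => x j n).trans (Fintype.card_fin r).le
    omega
  · intro t ht y hy
    filter_upwards [hspan t ht y hy] with n hn
    exact Algebra.span_le_adjoin _ _ hn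

variable (R : ValuationSubring RealGerm)

/-- Proper subalgebras of `E` have a proper limit in `K ⊗ E`. -/
theorem exists_limit_subalgebra [Fintype ι] (hKR : ∀ x ∈ K, x ∈ R)
    (hR : ∀ x : RealGerm, |x| ≤ 1 → x ∈ R)
    (hK : ∀ x ∈ R, ∃ y ∈ K, R.valuation (x - y) < 1)
    (V : ℕ → Subalgebra ℝ E) (hV : ∀ᶠ n in (hyperfilter ℕ : Filter ℕ), V n ≠ ⊤) :
    ∃ W : Subalgebra K (K ⊗[ℝ] E), W ≠ ⊤ ∧ ∀ x : ℕ → E,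
      (∀ᶠ n in (hyperfilter ℕ : Filter ℕ), x n ∈ V n) → ∀ t : K ⊗[ℝ] E,
        (∀ i, R.valuation (coordGerm b x i - coordExt b K t i) < 1) → t ∈ W := by
  have hrR : ∀ r : ℝ, algebraMap ℝ RealGerm r ∈ R := fun r => hKR _ (K.algebraMap_mem r)
  have hfunctional : ∀ᶠ n in (hyperfilter ℕ : Filter ℕ), ∃ f : ι → ℝ,
      ∑ i, f i * f i = 1 ∧ ∀ w ∈ V n, ∑ i, f i * b.repr w i = 0 := by
    filter_upwards [hV] with n hn
    obtain ⟨φ, hφ0, hφ⟩ := Submodule.exists_le_ker_of_lt_top (Subalgebra.toSubmodule (V n))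
      (lt_top_iff_ne_top.2 (by simpa using hn))
    have hex : ∃ i, φ (b i) ≠ 0 := by
      by_contra! h
      exact hφ0 (b.ext h)
    obtain ⟨i₀, hi₀⟩ := hex
    have hpos : 0 < ∑ i, φ (b i) * φ (b i) :=
      Finset.sum_pos' (fun i _ => mul_self_nonneg _)
        ⟨i₀, Finset.mem_univ _, mul_self_pos.2 hi₀⟩
    refine ⟨fun i => φ (b i) / √(∑ i, φ (b i) * φ (b i)), ?_, fun w hw => ?_⟩
    · simp only [div_mul_div_comm, Real.mul_self_sqrt hpos.le]
      rw [← Finset.sum_div, div_self hpos.ne']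
    · have : φ w = 0 := hφ hw
      rw [← b.sum_repr w, map_sum] at this
      simp only [div_mul_eq_mul_div]
      rw [← Finset.sum_div, div_eq_zero_iff]
      left
      simpa only [map_smul, smul_eq_mul, mul_comm] using this
  obtain ⟨f, hf⟩ := hfunctional.choice
  let φ : ι → RealGerm := fun i => ((fun n => f n i : ℕ → ℝ) : RealGerm)
  have hφR : ∀ i, φ i ∈ R := by
    intro i
    refine hR _ ?_
    rw [RealGerm.abs_coe, ← Germ.coe_one, Germ.coe_le]
    filter_upwards [hf] with n hn
    have h1 : f n i * f n i ≤ 1 := by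
      rw [← hn.1]
      exact Finset.single_le_sum (f := fun i => f n i * f n i)
        (fun i _ => mul_self_nonneg _) (Finset.mem_univ i)
    exact abs_le_one_iff_mul_self_le_one.2 h1
  choose g hgK hg using fun i => hK _ (hφR i)
  have hφ1 : ∑ i, φ i * φ i = 1 := by
    refine (RealGerm.coe_sum Finset.univ fun i n => f n i * f n i).symm.trans ?_
    rw [← Germ.coe_one, Germ.coe_eq]
    exact hf.mono fun n hn => hn.1
  have hmem : ∀ (x : ℕ → E) (t : K ⊗[ℝ] E),
      (∀ i, R.valuation (coordGerm b x i - coordExt b K t i) < 1) →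
      ∀ i, coordGerm b x i ∈ R := by
    intro x t h i
    have := R.add_mem _ _ ((R.valuation_le_one_iff _).1 (h i).le)
      (hKR _ (coordExt_mem b K t i))
    rwa [sub_add_cancel] at this
  let W : Subalgebra K (K ⊗[ℝ] E) :=
    { carrier := {t | ∃ x : ℕ → E, (∀ᶠ n in (hyperfilter ℕ : Filter ℕ), x n ∈ V n) ∧
        ∀ i, R.valuation (coordGerm b x i - coordExt b K t i) < 1}
      mul_mem' := by
        rintro s t ⟨x, hx, hxs⟩ ⟨y, hy, hyt⟩
        refine ⟨fun n => x n * y n, ?_, fun i => ?_⟩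
        · filter_upwards [hx, hy] with n h1 h2 using (V n).mul_mem h1 h2
        · rw [coordGerm_mul, coordExt_mul]
          simp only [← Finset.sum_sub_distrib]
          refine R.valuation.map_sum_lt one_ne_zero fun j _ =>
            R.valuation.map_sum_lt one_ne_zero fun l _ => ?_
          refine R.valuation_mul_sub_mul_lt_one
            (R.mul_mem _ _ (hKR _ (coordExt_mem b K s j)) (hKR _ (coordExt_mem b K t l)))
            (hrR _) ?_ (by simp)
          exact R.valuation_mul_sub_mul_lt_one (hKR _ (coordExt_mem b K s j))
            (hKR _ (coordExt_mem b K t l)) (hxs j) (hyt l)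
      add_mem' := by
        rintro s t ⟨x, hx, hxs⟩ ⟨y, hy, hyt⟩
        refine ⟨fun n => x n + y n, ?_, fun i => ?_⟩
        · filter_upwards [hx, hy] with n h1 h2 using (V n).add_mem h1 h2
        · rw [coordGerm_add, coordExt_add, add_sub_add_comm]
          exact R.valuation.map_add_lt (hxs i) (hyt i)
      algebraMap_mem' := by
        intro k
        obtain ⟨c, hc⟩ : ∃ c : ℕ → ℝ, (c : RealGerm) = k :=
          Germ.inductionOn (k : RealGerm) fun f => ⟨f, rfl⟩
        refine ⟨fun n => c n • 1, Eventually.of_forall fun n => (V n).smul_mem (V n).one_mem _,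
          fun i => ?_⟩
        rw [coordGerm_smul, coordGerm_const, Algebra.TensorProduct.algebraMap_apply,
          coordExt_tmul, hc]
        simp }
  refine ⟨W, ?_, fun x hx t ht => ⟨x, hx, ht⟩⟩
  have hker : ∀ t ∈ W, ∑ i, g i * coordExt b K t i = 0 := by
    rintro t ⟨x, hx, hxt⟩
    have h0 : ∑ i, φ i * coordGerm b x i = 0 := by
      refine (RealGerm.coe_sum Finset.univ fun i n => f n i * b.repr (x n) i).symm.trans ?_
      rw [← Germ.coe_zero, Germ.coe_eq]
      filter_upwards [hf, hx] with n hn hxn using hn.2 _ hxn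
    refine IntermediateField.eq_zero_of_valuation_lt_one hKR
      (K.sum_mem fun i _ => K.mul_mem (hgK i) (coordExt_mem b K t i)) ?_
    rw [← R.valuation.map_neg, ← zero_sub, ← h0, ← Finset.sum_sub_distrib]
    exact R.valuation.map_sum_lt one_ne_zero fun i _ =>
      R.valuation_mul_sub_mul_lt_one (hKR _ (hgK i)) (hKR _ (coordExt_mem b K t i))
        (hg i) (hxt i)
  intro htop
  have hg0 : ∑ i, g i * g i = 0 := by
    obtain ⟨t, ht⟩ := exists_coordExt_eq b K g hgK
    have := hker t (htop ▸ Algebra.mem_top)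
    simpa only [ht] using this
  have : R.valuation (∑ i, φ i * φ i - ∑ i, g i * g i) < 1 := by
    rw [← Finset.sum_sub_distrib]
    exact R.valuation.map_sum_lt one_ne_zero fun i _ =>
      R.valuation_mul_sub_mul_lt_one (hKR _ (hgK i)) (hKR _ (hgK i)) (hg i) (hg i)
  rw [hφ1, hg0] at this
  simp at this

end ExtensionOfScalars

section Generation

open scoped TensorProduct

theorem Algebra.exists_finset_adjoin_eq_top {k T : Type*} [Field k] [Ring T] [Algebra k T]
    [FiniteDimensional k T] {S : Set T} (hS : Algebra.adjoin k S = ⊤) :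
    ∃ F : Finset T, ↑F ⊆ S ∧ F.card ≤ Module.finrank k T ∧ Algebra.adjoin k (F : Set T) = ⊤ := by
  classical
  have key : ∀ n : ℕ, ∃ F : Finset T, ↑F ⊆ S ∧ F.card ≤ n ∧ (Algebra.adjoin k (F : Set T) = ⊤ ∨
      n ≤ Module.finrank k (Subalgebra.toSubmodule (Algebra.adjoin k (F : Set T)))) := by
    intro n
    induction n with
    | zero => exact ⟨∅, by simp, by simp, Or.inr (Nat.zero_le _)⟩
    | succ n ih =>
      obtain ⟨F, hFS, hFc, hF⟩ := ih
      by_cases htop : Algebra.adjoin k (F : Set T) = ⊤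
      · exact ⟨F, hFS, hFc.trans (Nat.le_succ n), Or.inl htop⟩
      have hnS : ¬ S ⊆ Algebra.adjoin k (F : Set T) := fun h =>
        htop (top_le_iff.1 (hS ▸ Algebra.adjoin_le h))
      obtain ⟨s, hsS, hs⟩ := Set.not_subset.1 hnS
      refine ⟨insert s F, ?_, (Finset.card_insert_le s F).trans (Nat.succ_le_succ hFc), Or.inr ?_⟩
      · rw [Finset.coe_insert]
        exact Set.insert_subset hsS hFS
      · refine Nat.succ_le_of_lt
          ((hF.resolve_left htop).trans_lt (Submodule.finrank_lt_finrank_of_lt ?_))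
        refine lt_of_le_of_ne (Algebra.adjoin_mono (by simp)) fun h => hs ?_
        have hmem : s ∈ Subalgebra.toSubmodule
            (Algebra.adjoin k ((insert s F : Finset T) : Set T)) :=
          Algebra.subset_adjoin (by simp)
        rw [← h] at hmem
        exact hmem
  obtain ⟨F, hFS, hFc, hF⟩ := key (Module.finrank k T)
  refine ⟨F, hFS, hFc, hF.elim (fun h => h) fun h => ?_⟩
  exact Algebra.toSubmodule_eq_top.1 (Submodule.eq_top_of_finrank_eq
    (le_antisymm (Submodule.finrank_le _) h))

theorem Algebra.exists_finset_adjoin_baseChange_eq_top {k K E : Type*} [Field k] [Field K]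
    [Algebra k K] [Ring E] [Algebra k E] [FiniteDimensional k E]
    {S : Set (K ⊗[k] E)} (hS : Algebra.adjoin K S = ⊤) :
    ∃ F : Finset (K ⊗[k] E), ↑F ⊆ S ∧ F.card ≤ Module.finrank k E ∧
      Algebra.adjoin K (F : Set (K ⊗[k] E)) = ⊤ := by
  obtain ⟨F, hFS, hFc, hF⟩ := Algebra.exists_finset_adjoin_eq_top hS
  rw [Module.finrank_baseChange] at hFc
  exact ⟨F, hFS, hFc, hF⟩

end Generation

section Seminorm

variable {E : Type*} [AddCommGroup E] [Module ℝ E]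

theorem Seminorm.exists_forall_abs_repr_le {ι : Type*} [Fintype ι] (b : Module.Basis ι ℝ E)
    (nm : Seminorm ℝ E) (hnm : ∀ x : E, nm x = 0 → x = 0) :
    ∃ M : ℝ, 0 < M ∧ ∀ x i, |b.repr x i| ≤ M * nm x := by
  let _ : NormedAddCommGroup E :=
    AddGroupNorm.toNormedAddCommGroup
      { nm.toAddGroupSeminorm with eq_zero_of_map_eq_zero' := hnm }
  let _ : NormedSpace ℝ E := ⟨fun r x => (map_smul_eq_mul nm r x).le⟩
  have : FiniteDimensional ℝ E := b.finiteDimensional_of_finite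
  let f := LinearMap.toContinuousLinearMap (b.equivFun : E →ₗ[ℝ] ι → ℝ)
  refine ⟨‖f‖ + 1, by positivity, fun x i => ?_⟩
  calc |b.repr x i| = ‖f x i‖ := rfl
    _ ≤ ‖f x‖ := norm_le_pi_norm _ i
    _ ≤ ‖f‖ * ‖x‖ := f.le_opNorm x
    _ ≤ (‖f‖ + 1) * ‖x‖ := by gcongr; linarith

theorem Seminorm.le_sum_abs_repr {ι : Type*} [Fintype ι] (b : Module.Basis ι ℝ E)
    (nm : Seminorm ℝ E) (x : E) : nm x ≤ ∑ i, |b.repr x i| * nm (b i) := by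
  conv_lhs => rw [← b.sum_repr x]
  refine (Finset.le_sum_of_subadditive nm (map_zero nm).le (map_add_le_add nm) _ _).trans ?_
  simp [map_smul_eq_mul]

theorem SDist_le (nm : Seminorm ℝ E) {a w : E} {W : Set E} (hw : w ∈ W) :
    SDist nm a W ≤ nm (a - w) :=
  csInf_le ⟨0, by rintro _ ⟨z, -, rfl⟩; exact apply_nonneg nm _⟩ ⟨w, hw, rfl⟩

theorem exists_lt_of_SDist_lt (nm : Seminorm ℝ E) {a : E} {W : Set E} (hW : W.Nonempty) {r : ℝ}
    (h : SDist nm a W < r) : ∃ w ∈ W, nm (a - w) < r := by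
  obtain ⟨_, ⟨w, hw, rfl⟩, hlt⟩ := exists_lt_of_csInf_lt (hW.image _) h
  exact ⟨w, hw, hlt⟩

end Seminorm

open scoped TensorProduct in
/-- For scales `ρ n` and sets `A n`, the conclusion with constants `C = n + 1` and `c = 1` holds
for some `n`; the proof passes to an ultraproduct. -/
theorem exists_away_finset_of_sequence {E : Type*} [Ring E] [Algebra ℝ E] [FiniteDimensional ℝ E]
    (nm : Seminorm ℝ E) (hnm : ∀ x : E, nm x = 0 → x = 0) (ρ : ℕ → ℝ) (hρ0 : ∀ n, 0 < ρ n)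
    (hρ : ∀ n, ρ n ≤ 1 / 2) (A : ℕ → Set E) (hA : ∀ n, A n ⊆ SBall nm 0 (ρ n)⁻¹)
    (haway : ∀ n, AwayFromSubalgebras nm (ρ n) (A n)) :
    ∃ n, ∃ A' : Finset E, ↑A' ⊆ A n ∧ A'.card ≤ Module.finrank ℝ E ∧
      AwayFromSubalgebras nm (ρ n ^ (n + 1)) ↑A' := by
  classical
  by_contra! hno
  simp only [AwayFromSubalgebras] at hno
  push Not at hno
  have hne : ∀ n, (A n).Nonempty := by
    intro n
    obtain ⟨W, hW, -⟩ := hno n ∅ (by simp) (by simp)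
    obtain ⟨a, ha, -⟩ := haway n W hW
    exact ⟨a, ha⟩
  let b := Module.finBasis ℝ E
  obtain ⟨M, hM0, hM⟩ := nm.exists_forall_abs_repr_le b hnm
  let τ : RealGerm := ((fun n => (ρ n)⁻¹ : ℕ → ℝ) : RealGerm)
  have hτ : 2 ≤ τ := by
    refine Germ.coe_le.2 (Eventually.of_forall fun n => ?_)
    change (2 : ℝ) ≤ (ρ n)⁻¹
    rw [← inv_inv (2 : ℝ)]
    exact inv_anti₀ (hρ0 n) (by simpa using hρ n)
  let R := moderateSubring τ hτ
  have hrR : ∀ r : ℝ, algebraMap ℝ RealGerm r ∈ R := by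
    intro r
    obtain ⟨k, hk⟩ := pow_unbounded_of_one_lt |r| (one_lt_two)
    refine ⟨k, ?_⟩
    refine le_trans ?_ (pow_le_pow_left₀ (by norm_num) hτ k)
    rw [RealGerm.algebraMap_apply, RealGerm.abs_coe]
    exact Germ.coe_le.2 (Eventually.of_forall fun n => hk.le)
  obtain ⟨K, hKR, hK⟩ := R.exists_coefficient_field (k := ℝ) hrR
    (fun _ _ => moderateSubring_valuation_le_of_abs_le) RealGerm.intermediateValue
  have hτR : τ ∈ R := ⟨1, by rw [abs_of_nonneg (by linarith), pow_one]⟩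
  have hlimit : ∀ a : ℕ → E, (∀ n, a n ∈ A n) → ∃ t : K ⊗[ℝ] E,
      ∀ i, R.valuation (coordGerm b a i - coordExt b K t i) < 1 := by
    intro a ha
    have hcoord : ∀ i, coordGerm b a i ∈ R := by
      intro i
      refine mem_moderateSubring_of_abs_le (y := algebraMap ℝ RealGerm M * τ) ?_
        (R.mul_mem _ _ (hrR M) hτR)
      rw [coordGerm, RealGerm.abs_coe, RealGerm.algebraMap_apply]
      refine Germ.coe_le.2 (Eventually.of_forall fun n => (hM _ i).trans ?_)
      have : nm (a n - 0) ≤ (ρ n)⁻¹ := hA n (ha n)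
      rw [sub_zero] at this
      exact mul_le_mul_of_nonneg_left this hM0.le
    choose g hgK hg using fun i => hK _ (hcoord i)
    obtain ⟨t, ht⟩ := exists_coordExt_eq b K g hgK
    exact ⟨t, fun i => by rw [ht]; exact hg i⟩
  let S : Set (K ⊗[ℝ] E) := {t | ∃ a : ℕ → E, (∀ n, a n ∈ A n) ∧
    ∀ i, R.valuation (coordGerm b a i - coordExt b K t i) < 1}
  by_cases hS : Algebra.adjoin K S = ⊤
  · obtain ⟨F, hFS, hFc, hF⟩ := Algebra.exists_finset_adjoin_baseChange_eq_top hS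
    have hF' : ∀ t : F, ∃ a : ℕ → E, (∀ n, a n ∈ A n) ∧
      ∀ i, R.valuation (coordGerm b a i - coordExt b K t i) < 1 := fun t => hFS t.2
    choose a haA hat using hF'
    have hno' := fun n => hno n (Finset.univ.image fun t => a t n)
      (by
        rw [Finset.coe_image]
        rintro _ ⟨t, -, rfl⟩
        exact haA t n)
      (Finset.card_image_le.trans (by simpa using hFc))
    choose V hV hVa using hno'
    obtain ⟨W, hW, hlim⟩ := exists_limit_subalgebra b K R hKR
      (fun x hx => ⟨0, by simpa using hx⟩) hK V (Eventually.of_forall hV)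
    refine hW (top_le_iff.1 (hF ▸ Algebra.adjoin_le fun t ht => ?_))
    have hw : ∀ n, ∃ w ∈ V n, nm (a ⟨t, ht⟩ n - w) < ρ n ^ (n + 1) := fun n =>
      exists_lt_of_SDist_lt nm ⟨0, (V n).zero_mem⟩
        (hVa n _ (by
          rw [Finset.coe_image]
          exact ⟨⟨t, ht⟩, by simp, rfl⟩))
    choose w hwV hw using hw
    refine hlim w (Eventually.of_forall hwV) t fun i => ?_
    have hsmall : R.valuation ((fun n => ρ n ^ (n + 1) : ℕ → ℝ) : RealGerm) < 1 := by
      refine moderateSubring_valuation_lt_one fun k => ?_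
      rw [RealGerm.abs_coe, ← Germ.coe_inv, ← Germ.coe_pow]
      refine Germ.coe_lt.2 ?_
      have hk : ∀ᶠ n in (hyperfilter ℕ : Filter ℕ), k < n + 1 :=
        ((eventually_ge_atTop k).mono fun n hn => Nat.lt_succ_of_le hn).filter_mono
          Nat.hyperfilter_le_atTop
      filter_upwards [hk] with n hn
      simp only [Pi.pow_apply, Pi.inv_apply, inv_inv]
      rw [abs_of_nonneg (pow_nonneg (hρ0 n).le _)]
      exact pow_lt_pow_right_of_lt_one₀ (hρ0 n) (by linarith [hρ n]) hn
    have haw : R.valuation (coordGerm b (a ⟨t, ht⟩) i - coordGerm b w i) < 1 := by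
      rw [← coordGerm_sub]
      refine (moderateSubring_valuation_le_of_abs_le
        (y := algebraMap ℝ RealGerm M * ((fun n => ρ n ^ (n + 1) : ℕ → ℝ) : RealGerm))
        ?_).trans_lt ?_
      · rw [coordGerm, RealGerm.abs_coe, RealGerm.algebraMap_apply]
        refine le_trans ?_ (le_abs_self _)
        exact Germ.coe_le.2 (Eventually.of_forall fun n => (hM _ i).trans
          (mul_le_mul_of_nonneg_left (hw n).le hM0.le))
      · rw [map_mul]
        exact mul_lt_one_of_nonneg_of_lt_one_right ((R.valuation_le_one_iff _).2 (hrR M))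
          zero_le hsmall
    rw [show coordGerm b w i - coordExt b K t i = coordGerm b (a ⟨t, ht⟩) i - coordExt b K t i -
      (coordGerm b (a ⟨t, ht⟩) i - coordGerm b w i) by ring]
    exact R.valuation.map_sub_lt (hat ⟨t, ht⟩ i) haw
  · obtain ⟨V, hV, hVW⟩ := exists_subalgebra_sequence b K _ hS
    have ha : ∀ n, ∃ a ∈ A n, V n ≠ ⊤ → ρ n ≤ SDist nm a (V n : Set E) := by
      intro n
      by_cases h : V n = ⊤
      · obtain ⟨a, ha⟩ := hne n
        exact ⟨a, ha, fun h' => absurd h h'⟩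
      · obtain ⟨a, ha, had⟩ := haway n (V n) h
        exact ⟨a, ha, fun _ => had⟩
    choose a haA haV using ha
    obtain ⟨t, ht⟩ := hlimit a haA
    obtain ⟨y, hy⟩ := exists_coordGerm_eq b K t
    have hyV := hVW t (Algebra.subset_adjoin ⟨a, haA, ht⟩) y hy
    have hle : τ⁻¹ ≤ ∑ i, |coordGerm b (fun n => a n - y n) i| *
        algebraMap ℝ RealGerm (nm (b i)) := by
      have : ∑ i, |coordGerm b (fun n => a n - y n) i| * algebraMap ℝ RealGerm (nm (b i)) =
          ((fun n => ∑ i, |b.repr (a n - y n) i| * nm (b i) : ℕ → ℝ) : RealGerm) := by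
        rw [RealGerm.coe_sum]
        refine Finset.sum_congr rfl fun i _ => ?_
        rw [coordGerm, RealGerm.abs_coe, RealGerm.algebraMap_apply]
        rfl
      rw [this, ← Germ.coe_inv]
      refine Germ.coe_le.2 ?_
      filter_upwards [hV, hyV] with n hn hyn
      rw [Pi.inv_apply, inv_inv]
      exact (haV n hn).trans ((SDist_le nm hyn).trans (nm.le_sum_abs_repr b _))
    have hlt : R.valuation (∑ i, |coordGerm b (fun n => a n - y n) i| *
        algebraMap ℝ RealGerm (nm (b i))) < 1 := by
      refine R.valuation.map_sum_lt one_ne_zero fun i _ => ?_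
      rw [map_mul, moderateSubring_valuation_abs, coordGerm_sub, hy]
      exact mul_lt_one_of_nonneg_of_lt_one_left zero_le (ht i)
        ((R.valuation_le_one_iff _).2 (hrR _))
    have hτ1 : R.valuation τ⁻¹ = 1 := by
      rw [map_inv₀, moderateSubring_valuation_self, inv_one]
    have hτ0 : 0 ≤ τ⁻¹ := inv_nonneg.2 (by linarith)
    refine absurd hlt (not_lt.2 ?_)
    rw [← hτ1]
    refine moderateSubring_valuation_le_of_abs_le ?_
    rw [abs_of_nonneg hτ0]
    exact hle.trans (le_abs_self _)

/-- **Lemma 3.1**: a bounded set which is `ρ`-away from subalgebras contains a subset of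
cardinality at most `dim_ℝ E` which is `c ρ^C`-away from subalgebras. -/
theorem finite_subset_away_from_subalgebras
    {E : Type*} [Ring E] [Algebra ℝ E] [FiniteDimensional ℝ E]
    (nm : Seminorm ℝ E) (hnm : ∀ x : E, nm x = 0 → x = 0) :
    ∃ C : ℝ, 1 ≤ C ∧ ∃ c : ℝ, 0 < c ∧
      ∀ ρ : ℝ, 0 < ρ → ρ ≤ 1 / 2 →
        ∀ A : Set E,
          A ⊆ SBall nm 0 ρ⁻¹ →
          AwayFromSubalgebras nm ρ A →
          ∃ A' : Finset E, ↑A' ⊆ A ∧ A'.card ≤ Module.finrank ℝ E ∧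
            AwayFromSubalgebras nm (c * ρ ^ C) ↑A' := by
  by_contra hcon
  push Not at hcon
  have hbad := fun n : ℕ => hcon ((n + 1 : ℕ) : ℝ) (by push_cast; linarith [n.cast_nonneg (α := ℝ)])
    1 one_pos
  choose ρ hρ0 hρ A hA haway hno using hbad
  obtain ⟨n, A', hA', hcard, h⟩ := exists_away_finset_of_sequence nm hnm ρ hρ0 hρ A hA haway
  refine hno n A' hA' hcard ?_
  rwa [one_mul, Real.rpow_natCast]
end

section
/- Let E be a finite-dimensional simple normed real algebra. There exist constants C ≥ 1 and c > 0 depending only on E such that the following holds for every 0 < ρ ≤ 1/2. Let A ⊆ B(0, ρ^{-1}) be a subset of E that is ρ-away from subalgebras. Then for every proper nonzero linear subspace W of E there exist w ∈ W with ‖w‖ ≤ 1 and a ∈ A such that dist(aw, W) ≥ cρ^C or dist(wa, W) ≥ cρ^C. -/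
open Pointwise

open Polynomial in
/-- A polynomial over an ultrapower of `ℝ` that changes sign on an interval has a root there. -/
theorem exists_root_germ_of_sign_change {α : Type*} {φ : Ultrafilter α}
    (p : (Filter.Germ (φ : Filter α) ℝ)[X]) {a b : Filter.Germ (φ : Filter α) ℝ} (hab : a ≤ b)
    (ha : p.eval a ≤ 0) (hb : 0 ≤ p.eval b) : ∃ z, a ≤ z ∧ z ≤ b ∧ p.eval z = 0 := by
  obtain ⟨P, rfl⟩ := Polynomial.map_surjective (Filter.Germ.coeRingHom (φ : Filter α))
    (fun x => Filter.Germ.inductionOn x fun f => ⟨f, rfl⟩) p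
  induction a using Filter.Germ.inductionOn with | _ a
  induction b using Filter.Germ.inductionOn with | _ b
  have key : ∀ t : α → ℝ, (P.map (Filter.Germ.coeRingHom (φ : Filter α))).eval
      (t : Filter.Germ (φ : Filter α) ℝ) =
      ((fun n => (P.map (Pi.evalRingHom (fun _ => ℝ) n)).eval (t n) : α → ℝ) :
        Filter.Germ (φ : Filter α) ℝ) := by
    intro t
    have h : (fun n => (P.map (Pi.evalRingHom (fun _ => ℝ) n)).eval (t n)) = P.eval t := by
      funext n
      exact Polynomial.eval_map_apply (Pi.evalRingHom (fun _ => ℝ) n) t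
    rw [h]
    exact Polynomial.eval_map_apply (Filter.Germ.coeRingHom (φ : Filter α)) t
  rw [key] at ha hb
  have ha' := Filter.Germ.coe_le.1 ha
  have hb' := Filter.Germ.coe_le.1 hb
  have hab' := Filter.Germ.coe_le.1 hab
  have : ∀ᶠ n in (φ : Filter α), ∃ z, a n ≤ z ∧ z ≤ b n ∧
      (P.map (Pi.evalRingHom (fun _ => ℝ) n)).eval z = 0 := by
    filter_upwards [ha', hb', hab'] with n h1 h2 h3
    obtain ⟨z, hz, hz0⟩ := intermediate_value_Icc h3
      (P.map (Pi.evalRingHom (fun _ => ℝ) n)).continuous.continuousOn ⟨h1, h2⟩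
    exact ⟨z, hz.1, hz.2, hz0⟩
  obtain ⟨z, hz⟩ := this.choice
  refine ⟨z, Filter.Germ.coe_le.2 (hz.mono fun _ h => h.1),
    Filter.Germ.coe_le.2 (hz.mono fun _ h => h.2.1), ?_⟩
  rw [key]
  exact Filter.Germ.coe_eq.2 (hz.mono fun _ h => h.2.2)

section ConvexSubring

variable {F : Type*} [Field F] [LinearOrder F]

/-- `x` is negligible with respect to the subring `O` if all its `O`-multiples are less than `1` in
absolute value. For convex `O` these are the elements of the maximal ideal of `O`. -/
def IsNegligible (O : Subring F) (x : F) : Prop := ∀ y ∈ O, |x * y| < 1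

/-- `O` contains every element dominated by one of its elements. -/
def IsConvexSubring (O : Subring F) : Prop := ∀ x : F, ∀ y ∈ O, |x| ≤ |y| → x ∈ O

namespace IsNegligible

variable {O : Subring F} {x y : F}

theorem mul_right (hx : IsNegligible O x) (hy : y ∈ O) : IsNegligible O (x * y) := fun z hz => by
  rw [mul_assoc]; exact hx _ (O.mul_mem hy hz)

theorem mul_left (hx : IsNegligible O x) (hy : y ∈ O) : IsNegligible O (y * x) :=
  mul_comm x y ▸ hx.mul_right hy

theorem abs_lt_one (hx : IsNegligible O x) : |x| < 1 := by simpa using hx 1 O.one_mem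

variable [IsStrictOrderedRing F]

theorem zero : IsNegligible O 0 := fun y _ => by simp

theorem add (hx : IsNegligible O x) (hy : IsNegligible O y) : IsNegligible O (x + y) := by
  intro z hz
  have h2 : (1 + 1) * z ∈ O := O.mul_mem (O.add_mem O.one_mem O.one_mem) hz
  have h1 := hx _ h2
  have h3 := hy _ h2
  rw [abs_lt] at *
  constructor <;> linarith [h1.1, h1.2, h3.1, h3.2]

theorem neg (hx : IsNegligible O x) : IsNegligible O (-x) := fun y hy => by
  simpa using hx y hy

theorem of_abs_le (hx : IsNegligible O x) (h : |y| ≤ |x|) : IsNegligible O y := fun z hz => by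
  refine lt_of_le_of_lt ?_ (hx z hz)
  rw [abs_mul, abs_mul]
  gcongr

theorem mem (hO : IsConvexSubring O) (hx : IsNegligible O x) : x ∈ O :=
  hO _ 1 O.one_mem (by simpa using hx.abs_lt_one.le)

theorem inv_notMem (hx : IsNegligible O x) (h0 : x ≠ 0) : x⁻¹ ∉ O := fun h => by
  simpa [h0] using hx _ h

theorem inv_mem (hO : IsConvexSubring O) (hx : ¬ IsNegligible O x) : x⁻¹ ∈ O := by
  simp only [IsNegligible, not_forall, not_lt] at hx
  obtain ⟨y, hy, h⟩ := hx
  refine hO _ y hy ?_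
  have h0 : x ≠ 0 := by rintro rfl; simp at h; linarith
  rw [abs_mul] at h
  rw [abs_inv, inv_le_iff_one_le_mul₀ (abs_pos.2 h0)]
  linarith

end IsNegligible

open Polynomial

variable [IsStrictOrderedRing F]

/-- Newton's lemma for a convex subring of an ordered field with the intermediate value property:
an approximate simple root of a polynomial is close to a root. -/
theorem IsConvexSubring.exists_root_of_isNegligible {O : Subring F} (hO : IsConvexSubring O)
    (hF : ∀ (p : F[X]) (a b : F), a ≤ b → p.eval a ≤ 0 → 0 ≤ p.eval b →
      ∃ z, a ≤ z ∧ z ≤ b ∧ p.eval z = 0)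
    (p : O[X]) (x : O) (hp : IsNegligible O ((p.eval x : O) : F))
    (hp' : ¬ IsNegligible O ((p.derivative.eval x : O) : F)) :
    ∃ z : F, IsNegligible O (z - x) ∧ (p.map O.subtype).eval z = 0 := by
  wlog hpos : 0 < ((p.derivative.eval x : O) : F) generalizing p
  · have hne : ((p.derivative.eval x : O) : F) ≠ 0 := fun h => hp' (h ▸ IsNegligible.zero)
    obtain ⟨z, hz, hz0⟩ := this (-p) (by simpa using hp.neg)
      (fun h => hp' (by simpa using h.neg)) (by
        simpa using lt_of_le_of_ne (not_lt.1 hpos) hne)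
    exact ⟨z, hz, by simpa using hz0⟩
  set u : F := ((p.derivative.eval x : O) : F) with hu
  set v : F := ((p.eval x : O) : F) with hv
  set e : F := 2 * |v| * u⁻¹ with he
  have hinv : u⁻¹ ∈ O := IsNegligible.inv_mem hO hp'
  have hen : IsNegligible O e := by
    refine (IsNegligible.of_abs_le (hp.add hp) ?_).mul_right hinv
    rw [abs_mul, abs_abs, ← two_mul, abs_mul]
  have he0 : 0 ≤ e := by positivity
  have hue : u * e = 2 * |v| := by rw [he]; field_simp [hpos.ne']
  have hmap : ∀ t : O, (p.map O.subtype).eval (t : F) = ((p.eval t : O) : F) := fun t =>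
    Polynomial.eval_map_apply O.subtype t
  have expand : ∀ t : O, IsNegligible O (t : F) → (t : F) ^ 2 = e ^ 2 →
      ∃ k : F, (p.map O.subtype).eval (x + t : F) = v + u * t + k ∧ |k| ≤ |v| := by
    intro t ht hte
    obtain ⟨k, hk⟩ := Polynomial.binomExpansion p x t
    refine ⟨k * t ^ 2, ?_, ?_⟩
    · have := hmap (x + t)
      rw [hk] at this
      push_cast at this
      exact this
    · have h1 := (hen.mul_right hinv) ((1 + 1) * k) (O.mul_mem (O.add_mem O.one_mem O.one_mem) k.2)
      have h2 : |(k : F)| * e ≤ u / 2 := by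
        have : e * u⁻¹ * ((1 + 1) * (k : F)) = (2 * (k * e)) / u := by ring
        rw [this, abs_div, abs_of_pos hpos, div_lt_one hpos, abs_mul, abs_mul, abs_of_nonneg he0,
          abs_of_pos (two_pos : (0 : F) < 2)] at h1
        linarith
      rw [hte, abs_mul, abs_of_nonneg (sq_nonneg e)]
      nlinarith
  obtain ⟨k₁, h1, hk1⟩ := expand ⟨e, hen.mem hO⟩ hen rfl
  obtain ⟨k₂, h2, hk2⟩ := expand ⟨-e, hen.neg.mem hO⟩ hen.neg (by simp)
  simp only at h1 h2
  have a1 := abs_le.1 hk1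
  have a2 := abs_le.1 hk2
  obtain ⟨z, hz1, hz2, hz⟩ := hF (p.map O.subtype) (x + -e) (x + e) (by linarith)
    (by rw [h2]; nlinarith [le_abs_self v]) (by rw [h1]; nlinarith [neg_abs_le v])
  refine ⟨z, hen.of_abs_le ?_, hz⟩
  rw [abs_of_nonneg he0, abs_le]
  constructor <;> linarith

/-- A convex subring of an ordered field with the intermediate value property contains a field of
representatives of its residue field, extending any given subfield. -/
theorem IsConvexSubring.exists_subfield_representatives {O : Subring F} (hO : IsConvexSubring O)
    (hF : ∀ (p : F[X]) (a b : F), a ≤ b → p.eval a ≤ 0 → 0 ≤ p.eval b →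
      ∃ z, a ≤ z ∧ z ≤ b ∧ p.eval z = 0)
    (k : Subfield F) (hk : (k : Set F) ⊆ O) :
    ∃ L : Subfield F, k ≤ L ∧ (L : Set F) ⊆ O ∧ ∀ x ∈ O, ∃ y ∈ L, IsNegligible O (x - y) := by
  obtain ⟨L, hkL, hmax⟩ := zorn_le_nonempty₀ {L : Subfield F | (L : Set F) ⊆ O}
    (fun c hc hchain y hy => ⟨sSup c, by
      have : (sSup c : Subfield F) = ⋃ s ∈ c, (s : Set F) :=
        Subfield.coe_sSup_of_directedOn ⟨y, hy⟩ hchain.directedOn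
      simp only [Set.mem_ofPred_eq, this, Set.iUnion_subset_iff]
      exact fun s hs => hc hs, fun z hz => le_sSup hz⟩) k hk
  have hLO : (L : Set F) ⊆ O := hmax.prop
  refine ⟨L, hkL, hLO, fun x hx => ?_⟩
  let i : L →+* O := L.subtype.codRestrict O fun y => hLO y.2
  have hi : ∀ (p : L[X]) (z : O), (((p.map i).eval z : O) : F) = aeval (z : F) p := by
    intro p z
    rw [eval_map, aeval_def]
    exact hom_eval₂ p i O.subtype z
  have hmem : ∀ (p : L[X]) (z : O), aeval (z : F) p ∈ O := fun p z => hi p z ▸ SetLike.coe_mem _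
  have hext : ∀ z : F, (∀ w ∈ IntermediateField.adjoin L {z}, w ∈ O) → z ∈ L := by
    intro z hz
    have h1 : L ≤ (IntermediateField.adjoin L {z}).toSubfield := fun y hy =>
      (IntermediateField.adjoin L {z}).algebraMap_mem ⟨y, hy⟩
    exact hmax.le_of_ge (y := (IntermediateField.adjoin L {z}).toSubfield) hz h1
      (IntermediateField.mem_adjoin_simple_self L z)
  by_cases halg : ∀ p : L[X], p ≠ 0 → ¬ IsNegligible O (aeval x p)
  · refine ⟨x, hext x fun w hw => ?_, by simpa using IsNegligible.zero⟩
    obtain ⟨r, s, rfl⟩ := (IntermediateField.mem_adjoin_simple_iff L w).1 hw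
    rw [div_eq_mul_inv]
    refine O.mul_mem (hmem r ⟨x, hx⟩) ?_
    by_cases hs : s = 0
    · simp [hs]
    · exact IsNegligible.inv_mem hO (halg s hs)
  · push Not at halg
    obtain ⟨p, ⟨hp0, hpn⟩, hmin⟩ := exists_minimalFor_of_wellFoundedLT
      (fun p : L[X] => p ≠ 0 ∧ IsNegligible O (aeval x p)) natDegree halg
    have hdeg : p.natDegree ≠ 0 := by
      intro h
      obtain ⟨c, rfl⟩ := natDegree_eq_zero.1 h
      have hc : (c : F) ≠ 0 := fun h => hp0 (by simpa using h)
      rw [aeval_C] at hpn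
      exact hpn.inv_notMem hc (hLO (L.inv_mem c.2))
    have hp' : ¬ IsNegligible O (aeval x (derivative p)) := by
      intro h
      have h0 : derivative p ≠ 0 := fun h => hdeg (derivative_eq_zero.1 h)
      exact (natDegree_derivative_lt hdeg).not_ge
        (hmin ⟨h0, h⟩ (natDegree_derivative_lt hdeg).le)
    obtain ⟨z, hzx, hz⟩ := hO.exists_root_of_isNegligible hF (p.map i) ⟨x, hx⟩
      (by rwa [hi]) (by rwa [derivative_map, hi])
    have hzO : z ∈ O := by simpa using O.add_mem (hzx.mem hO) hx
    refine ⟨z, hext z fun w hw => ?_, by simpa using hzx.neg⟩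
    have hint : IsIntegral L z := by
      refine IsAlgebraic.isIntegral ⟨p, hp0, ?_⟩
      rw [← hi p ⟨z, hzO⟩]
      exact (Polynomial.eval_map_apply O.subtype (⟨z, hzO⟩ : O)).symm.trans hz
    rw [← IntermediateField.mem_toSubalgebra,
      IntermediateField.adjoin_simple_toSubalgebra_of_isAlgebraic hint.isAlgebraic,
      Algebra.adjoin_singleton_eq_range_aeval] at hw
    obtain ⟨q, rfl⟩ := hw
    exact hmem q ⟨z, hzO⟩

end ConvexSubring

namespace IsNegligible

variable {F : Type*} [Field F] [LinearOrder F] [IsStrictOrderedRing F] {O : Subring F}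

/-- Polynomials with coefficients in `O` respect congruence modulo negligible elements. -/
theorem eval₂_sub_eval₂ {R σ : Type*} [CommSemiring R] {κ : R →+* F} (hO : IsConvexSubring O)
    (hκ : ∀ r, κ r ∈ O) {x y : σ → F} (hx : ∀ j, x j ∈ O) (hxy : ∀ j, IsNegligible O (x j - y j))
    (p : MvPolynomial σ R) :
    p.eval₂ κ x ∈ O ∧ IsNegligible O (p.eval₂ κ x - p.eval₂ κ y) := by
  have hmem : ∀ {a b : F}, a ∈ O → IsNegligible O (a - b) → b ∈ O := fun ha hab => by
    simpa using O.sub_mem ha (hab.mem hO)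
  induction p using MvPolynomial.induction_on with
  | C a => simpa using ⟨hκ a, zero⟩
  | add p q hp hq =>
    simp only [MvPolynomial.eval₂_add]
    refine ⟨O.add_mem hp.1 hq.1, ?_⟩
    rw [add_sub_add_comm]
    exact hp.2.add hq.2
  | mul_X p j hp =>
    simp only [MvPolynomial.eval₂_mul, MvPolynomial.eval₂_X]
    refine ⟨O.mul_mem hp.1 (hx j), ?_⟩
    have : p.eval₂ κ x * x j - p.eval₂ κ y * y j =
        (p.eval₂ κ x - p.eval₂ κ y) * x j + p.eval₂ κ y * (x j - y j) := by ring
    rw [this]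
    exact (hp.2.mul_right (hx j)).add ((hxy j).mul_left (hmem hp.1 hp.2))

end IsNegligible

/-- The elements of polynomial growth in `R`. -/
def polynomialGrowthSubring {F : Type*} [Field F] [LinearOrder F] [IsStrictOrderedRing F]
    (R : F) (hR : 2 ≤ R) : Subring F where
  carrier := {x | ∃ k : ℕ, |x| ≤ R ^ k}
  mul_mem' := by
    rintro x y ⟨k, hk⟩ ⟨l, hl⟩
    refine ⟨k + l, ?_⟩
    rw [abs_mul, pow_add]
    gcongr
  one_mem' := ⟨0, by simp⟩
  add_mem' := by
    rintro x y ⟨k, hk⟩ ⟨l, hl⟩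
    have h1 : (1 : F) ≤ R := by linarith
    have hk' := hk.trans (pow_le_pow_right₀ h1 (le_max_left k l))
    have hl' := hl.trans (pow_le_pow_right₀ h1 (le_max_right k l))
    refine ⟨max k l + 1, (abs_add_le x y).trans ?_⟩
    rw [pow_succ]
    nlinarith [pow_nonneg (zero_le_one.trans h1) (max k l)]
  zero_mem' := ⟨0, by simp⟩
  neg_mem' := by
    rintro x ⟨k, hk⟩
    exact ⟨k, by rwa [abs_neg]⟩

theorem isConvexSubring_polynomialGrowthSubring {F : Type*} [Field F] [LinearOrder F]
    [IsStrictOrderedRing F] (R : F) (hR : 2 ≤ R) :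
    IsConvexSubring (polynomialGrowthSubring R hR) := by
  rintro x y ⟨k, hk⟩ h
  exact ⟨k, h.trans hk⟩

theorem Filter.Germ.eval₂_coe {α σ : Type*} {l : Filter α} (p : MvPolynomial σ ℝ)
    (x : σ → α → ℝ) :
    p.eval₂ ((Filter.Germ.coeRingHom l).comp (Pi.constRingHom α ℝ)) (fun j => (x j : Germ l ℝ)) =
      ((fun n => MvPolynomial.eval (fun j => x j n) p : α → ℝ) : Germ l ℝ) := by
  have h : (fun n => MvPolynomial.eval (fun j => x j n) p) =
      p.eval₂ (Pi.constRingHom α ℝ) x := by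
    funext n
    have := MvPolynomial.eval₂_comp_left (Pi.evalRingHom (fun _ => ℝ) n) (Pi.constRingHom α ℝ) x p
    exact this.symm
  rw [h]
  exact (MvPolynomial.eval₂_comp_left (Filter.Germ.coeRingHom l) (Pi.constRingHom α ℝ) x p).symm

/-- A Łojasiewicz inequality with parameters: if finitely many real polynomials nearly vanish at
`(x, s)` for all `s` in a set `S`, then `x` can be moved slightly to some `y`, independent of `s`,
and each `s ∈ S` can be moved slightly to some `s'`, so that they vanish exactly at `(y, s')`. -/
theorem MvPolynomial.exists_pow_forall_exists_common_zero {σ τ ι : Type*} [Finite σ] [Finite τ]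
    [Finite ι] (f : ι → MvPolynomial (σ ⊕ τ) ℝ) :
    ∃ C : ℕ, ∀ ρ : ℝ, 0 < ρ → ρ ≤ 1 / 2 → ∀ x : σ → ℝ, (∀ j, |x j| ≤ ρ⁻¹) →
      ∀ S : Set (τ → ℝ), (∀ s ∈ S, ∀ j, |s j| ≤ ρ⁻¹) →
        (∀ s ∈ S, ∀ i, |eval (Sum.elim x s) (f i)| ≤ ρ ^ C) →
        ∃ y : σ → ℝ, (∀ j, |x j - y j| ≤ ρ) ∧
          ∀ s ∈ S, ∃ s' : τ → ℝ, (∀ j, |s j - s' j| ≤ ρ) ∧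
            ∀ i, eval (Sum.elim y s') (f i) = 0 := by
  by_contra! H
  choose ρ hρ0 hρ x hx S hS hf hcon using H
  let φ : Filter ℕ := Filter.hyperfilter ℕ
  let F := Filter.Germ φ ℝ
  let r : F := ((fun n => ρ n : ℕ → ℝ) : Filter.Germ φ ℝ)
  have hr0 : 0 < r := Filter.Germ.coe_pos.2 (.of_forall hρ0)
  have hR : 2 ≤ r⁻¹ := Filter.Germ.coe_le.2 (.of_forall fun n => by
    change (2 : ℝ) ≤ (ρ n)⁻¹
    rw [le_inv_comm₀ two_pos (hρ0 n)]
    simpa using hρ n)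
  let O := polynomialGrowthSubring r⁻¹ hR
  have hO : IsConvexSubring O := isConvexSubring_polynomialGrowthSubring _ _
  have hrO : r⁻¹ ∈ O := ⟨1, by rw [pow_one, abs_of_pos (inv_pos.2 hr0)]⟩
  have hsmall : ∀ u : ℕ → ℝ, IsNegligible O (u : F) → ∀ᶠ n in φ, |u n| ≤ ρ n := by
    intro u hu
    have h := hu _ hrO
    rw [abs_mul, abs_of_pos (inv_pos.2 hr0), ← div_eq_mul_inv, div_lt_one hr0,
      Filter.Germ.abs_def] at h
    exact (Filter.Germ.coe_lt.1 h).mono fun _ h => h.le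
  have hbdd : ∀ u : ℕ → ℝ, (∀ᶠ n in φ, |u n| ≤ (ρ n)⁻¹) → (u : F) ∈ O := by
    intro u hu
    refine hO _ _ hrO ?_
    rw [abs_of_pos (inv_pos.2 hr0), Filter.Germ.abs_def]
    exact Filter.Germ.coe_le.2 hu
  let κ : ℝ →+* F := (Filter.Germ.coeRingHom φ).comp (Pi.constRingHom ℕ ℝ)
  have hκ : ∀ t, κ t ∈ O := by
    intro t
    obtain ⟨k, hk⟩ := pow_unbounded_of_one_lt |t| (one_lt_two (α := ℝ))
    refine ⟨k, ?_⟩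
    calc |κ t| ≤ 2 ^ k := by
          rw [Filter.Germ.abs_def]
          exact Filter.Germ.coe_le.2 (.of_forall fun n => hk.le)
      _ ≤ _ := by gcongr
  obtain ⟨L, hkL, hLO, hL⟩ := hO.exists_subfield_representatives
    exists_root_germ_of_sign_change κ.fieldRange (by rintro _ ⟨t, rfl⟩; exact hκ t)
  have happrox : ∀ u : ℕ → ℝ, (∀ᶠ n in φ, |u n| ≤ (ρ n)⁻¹) →
      ∃ v : ℕ → ℝ, (v : F) ∈ L ∧ IsNegligible O ((u : F) - v) := by
    intro u hu
    obtain ⟨y, hy, h⟩ := hL _ (hbdd u hu)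
    induction y using Filter.Germ.inductionOn with | _ v
    exact ⟨v, hy, h⟩
  choose y hyL hy using fun j => happrox (fun n => x n j) (.of_forall fun n => hx n j)
  have hxy : ∀ᶠ n in φ, ∀ j, |x n j - y j n| ≤ ρ n :=
    Filter.eventually_all.2 fun j => hsmall _ (hy j)
  have hs : ∀ᶠ n in φ, ∃ s ∈ S n, ∀ s' : τ → ℝ, (∀ j, |s j - s' j| ≤ ρ n) →
      ∃ i, eval (Sum.elim (fun j => y j n) s') (f i) ≠ 0 :=
    hxy.mono fun n hn => hcon n _ hn
  obtain ⟨s, hs⟩ := hs.choice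
  choose t htL ht using fun j => happrox (fun n => s n j) (hs.mono fun n h => hS n _ h.1 j)
  have hst : ∀ᶠ n in φ, ∀ j, |s n j - t j n| ≤ ρ n :=
    Filter.eventually_all.2 fun j => hsmall _ (ht j)
  let X : σ ⊕ τ → ℕ → ℝ := Sum.elim (fun j n => x n j) (fun j n => s n j)
  let Y : σ ⊕ τ → ℕ → ℝ := Sum.elim y t
  have hX : ∀ n, (fun j => X j n) = Sum.elim (x n) (s n) := fun n => by ext (j | j) <;> rfl
  have hY : ∀ n, (fun j => Y j n) = Sum.elim (fun j => y j n) (fun j => t j n) := fun n => by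
    ext (j | j) <;> rfl
  have hXO : ∀ j, (X j : F) ∈ O := by
    rintro (j | j)
    · exact hbdd _ (.of_forall fun n => hx n j)
    · exact hbdd _ (hs.mono fun n h => hS n _ h.1 j)
  have hXY : ∀ j, IsNegligible O ((X j : F) - Y j) := by
    rintro (j | j)
    exacts [hy j, ht j]
  have hYL : ∀ j, (Y j : F) ∈ L := by
    rintro (j | j)
    exacts [hyL j, htL j]
  have hzero : ∀ i, ∀ᶠ n in φ, eval (fun j => Y j n) (f i) = 0 := by
    intro i
    have hnegl : IsNegligible O ((f i).eval₂ κ fun j => (X j : F)) := by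
      rintro z ⟨k, hk⟩
      have hle : |(f i).eval₂ κ fun j => (X j : F)| ≤ r ^ (k + 1) := by
        rw [Filter.Germ.eval₂_coe, Filter.Germ.abs_def]
        refine Filter.Germ.coe_le.2 ?_
        filter_upwards [hs, Nat.hyperfilter_le_atTop (Filter.eventually_ge_atTop (k + 1))]
          with n hn hkn
        simp only [hX]
        exact (hf n _ hn.1 i).trans
          (pow_le_pow_of_le_one (hρ0 n).le ((hρ n).trans (by norm_num)) hkn)
      have hr1 : r < 1 := by
        have := inv_lt_one_of_one_lt₀ (lt_of_lt_of_le one_lt_two hR)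
        rwa [inv_inv] at this
      rw [abs_mul]
      calc _ ≤ r ^ (k + 1) * r⁻¹ ^ k := by gcongr
        _ = r := by rw [pow_succ', inv_pow, mul_assoc, mul_inv_cancel₀ (by positivity), mul_one]
        _ < 1 := hr1
    have hYn : IsNegligible O ((f i).eval₂ κ fun j => (Y j : F)) := by
      simpa using hnegl.add (IsNegligible.eval₂_sub_eval₂ hO hκ hXO hXY (f i)).2.neg
    have hmem : ((f i).eval₂ κ fun j => (Y j : F)) ∈ L := by
      rw [MvPolynomial.eval₂_eq]
      exact sum_mem fun d _ => L.mul_mem (hkL ⟨_, rfl⟩)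
        (prod_mem fun j _ => L.pow_mem (hYL j) _)
    have h0 : ((f i).eval₂ κ fun j => (Y j : F)) = 0 := by
      by_contra h0
      exact hYn.inv_notMem h0 (hLO (L.inv_mem hmem))
    rw [Filter.Germ.eval₂_coe] at h0
    exact Filter.Germ.coe_eq.1 h0
  obtain ⟨n, hn, hn', hn0⟩ := (hs.and (hst.and (Filter.eventually_all.2 hzero))).exists
  obtain ⟨i, hi⟩ := hn.2 _ hn'
  exact hi (by rw [← hY]; exact hn0 i)

/-- The elements stabilising a submodule under both left and right multiplication. -/
def Submodule.twoSidedStabilizer {R E : Type*} [CommRing R] [Ring E] [Algebra R E]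
    (W : Submodule R E) : Subalgebra R E where
  carrier := {x | ∀ w ∈ W, x * w ∈ W ∧ w * x ∈ W}
  mul_mem' {x y} hx hy w hw :=
    ⟨by rw [mul_assoc]; exact (hx _ (hy w hw).1).1, by rw [← mul_assoc]; exact (hy _ (hx w hw).2).2⟩
  add_mem' {x y} hx hy w hw :=
    ⟨by rw [add_mul]; exact W.add_mem (hx w hw).1 (hy w hw).1,
      by rw [mul_add]; exact W.add_mem (hx w hw).2 (hy w hw).2⟩
  algebraMap_mem' r w hw :=
    ⟨by rw [← Algebra.smul_def]; exact W.smul_mem r hw,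
      by rw [← Algebra.commutes, ← Algebra.smul_def]; exact W.smul_mem r hw⟩

theorem Submodule.twoSidedStabilizer_ne_top {R E : Type*} [CommRing R] [Ring E] [Algebra R E]
    [IsSimpleRing E] {W : Submodule R E} (hbot : W ≠ ⊥) (htop : W ≠ ⊤) :
    W.twoSidedStabilizer ≠ ⊤ := by
  intro h
  have hW : ∀ x, ∀ w ∈ W, x * w ∈ W ∧ w * x ∈ W := fun x => by
    have : x ∈ W.twoSidedStabilizer := h ▸ Algebra.mem_top
    exact this
  let I : TwoSidedIdeal E := TwoSidedIdeal.mk' W W.zero_mem W.add_mem W.neg_mem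
    (fun {x y} hy => (hW x y hy).1) (fun {x y} hx => (hW y x hx).2)
  have hI : ∀ x, x ∈ I ↔ x ∈ W := fun x => TwoSidedIdeal.mem_mk' ..
  rcases eq_bot_or_eq_top I with h | h
  · exact hbot (W.eq_bot_iff.2 fun x hx => by
      have := (hI x).2 hx
      rwa [h, TwoSidedIdeal.mem_bot] at this)
  · exact htop (W.eq_top_iff'.2 fun x => (hI x).1 (h ▸ TwoSidedIdeal.mem_top E))

/-- A norm on a finite-dimensional space is equivalent to the sup norm of coordinates. -/
theorem Seminorm.exists_bound_repr {E ι : Type*} [AddCommGroup E] [Module ℝ E] [Fintype ι]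
    (b : Module.Basis ι ℝ E) (nm : Seminorm ℝ E) (hnm : ∀ x : E, nm x = 0 → x = 0) :
    ∃ M : ℝ, 1 ≤ M ∧ (∀ x : E, ∀ t : ℝ, 0 ≤ t → (∀ i, |b.repr x i| ≤ t) → nm x ≤ M * t) ∧
      ∀ x : E, ∀ i, |b.repr x i| ≤ M * nm x := by
  let e : E ≃ₗ[ℝ] ι → ℝ := b.equivFun
  let _ : Norm E := ⟨nm⟩
  have core : NormedSpace.Core ℝ E :=
    { norm_nonneg := fun x => apply_nonneg nm x
      norm_smul := fun c x => map_smul_eq_mul nm c x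
      norm_triangle := fun x y => map_add_le_add nm x y
      norm_eq_zero_iff := fun x => ⟨hnm x, fun h => h ▸ map_zero nm⟩ }
  let _ : NormedAddCommGroup E := NormedAddCommGroup.ofCore core
  let _ : NormedSpace ℝ E := NormedSpace.ofCore core
  have : FiniteDimensional ℝ E := b.finiteDimensional_of_finite
  let f : E ≃L[ℝ] ι → ℝ := e.toContinuousLinearEquiv
  refine ⟨max 1 (max ‖(f : E →L[ℝ] ι → ℝ)‖ ‖(f.symm : (ι → ℝ) →L[ℝ] E)‖), le_max_left _ _,
    fun x t ht h => ?_, fun x i => ?_⟩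
  · calc nm x = ‖(f.symm : (ι → ℝ) →L[ℝ] E) (f x)‖ := by simp; rfl
      _ ≤ ‖(f.symm : (ι → ℝ) →L[ℝ] E)‖ * ‖f x‖ := ContinuousLinearMap.le_opNorm _ _
      _ ≤ _ := by
        gcongr
        · exact (le_max_right _ _).trans (le_max_right _ _)
        · exact (pi_norm_le_iff_of_nonneg ht).2 h
  · calc |b.repr x i| = ‖f x i‖ := rfl
      _ ≤ ‖f x‖ := norm_le_pi_norm _ i
      _ ≤ ‖(f : E →L[ℝ] ι → ℝ)‖ * ‖x‖ := (f : E →L[ℝ] ι → ℝ).le_opNorm x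
      _ ≤ _ := mul_le_mul_of_nonneg_right ((le_max_left _ _).trans (le_max_right _ _))
        (norm_nonneg x)

theorem exists_projection_toMatrix_le_one {E : Type*} [AddCommGroup E] [Module ℝ E] {ι : Type*}
    [Fintype ι] [DecidableEq ι] (b : Module.Basis ι ℝ E) (W : Submodule ℝ E) :
    ∃ Q : E →ₗ[ℝ] E, LinearMap.IsProj W Q ∧ ∀ i j, |LinearMap.toMatrix b b Q i j| ≤ 1 := by
  let e : E ≃ₗ[ℝ] EuclideanSpace ℝ ι := b.equivFun.trans (WithLp.linearEquiv 2 ℝ (ι → ℝ)).symm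
  let K := W.map (e : E →ₗ[ℝ] EuclideanSpace ℝ ι)
  refine ⟨e.symm ∘ₗ (K.starProjection : EuclideanSpace ℝ ι →ₗ[ℝ] EuclideanSpace ℝ ι) ∘ₗ e,
    ⟨fun x => ?_, fun x hx => ?_⟩, fun i j => ?_⟩
  · obtain ⟨w, hw, h⟩ := Submodule.mem_map.1 (K.starProjection_apply_mem (e x))
    have : e.symm (K.starProjection (e x)) = w := by rw [← h]; simp
    simpa [this] using hw
  · have : K.starProjection (e x) = e x :=
      Submodule.starProjection_eq_self_iff.2 (Submodule.mem_map_of_mem hx)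
    simp [this]
  · have h1 : e (b j) = EuclideanSpace.single j 1 := by
      ext k; simp [e, Finsupp.single_apply, eq_comm]
    have h2 : ∀ v : EuclideanSpace ℝ ι, b.repr (e.symm v) i = v i := fun v =>
      congrFun (b.equivFun.apply_symm_apply v.ofLp) i
    rw [LinearMap.toMatrix_apply]
    simp only [LinearMap.comp_apply, LinearEquiv.coe_coe, ContinuousLinearMap.coe_coe, h1, h2]
    calc _ ≤ ‖K.starProjection (EuclideanSpace.single j 1)‖ := PiLp.norm_apply_le _ i
      _ ≤ ‖EuclideanSpace.single j (1 : ℝ)‖ := K.norm_starProjection_apply_le _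
      _ = 1 := by simp

/-- If `A` nearly stabilises the range of the idempotent matrix `P` under the linear maps `T t`,
then there is an idempotent `P'` near `P` whose range is exactly stabilised by elements near those
of `A`. -/
theorem exists_pow_forall_exists_idempotent {E κ n : Type*} [AddCommGroup E] [Module ℝ E] [Finite κ]
    [Fintype n] [DecidableEq n] (b : Module.Basis n ℝ E) (T : κ → E →ₗ[ℝ] Matrix n n ℝ) :
    ∃ C : ℕ, ∀ ρ : ℝ, 0 < ρ → ρ ≤ 1 / 2 → ∀ P : Matrix n n ℝ, (∀ i j, |P i j| ≤ ρ⁻¹) → P * P = P →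
      ∀ A : Set E, A.Nonempty → (∀ a ∈ A, ∀ i, |b.repr a i| ≤ ρ⁻¹) →
        (∀ a ∈ A, ∀ t i j, |((1 - P) * T t a * P) i j| ≤ ρ ^ C) →
        ∃ P' : Matrix n n ℝ, (∀ i j, |P i j - P' i j| ≤ ρ) ∧ P' * P' = P' ∧
          ∀ a ∈ A, ∃ a' : E, (∀ i, |b.repr (a - a') i| ≤ ρ) ∧ ∀ t, (1 - P') * T t a' * P' = 0 := by
  let Pm : Matrix n n (MvPolynomial ((n × n) ⊕ n) ℝ) :=
    Matrix.of fun i j => MvPolynomial.X (Sum.inl (i, j))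
  let Tm : κ → Matrix n n (MvPolynomial ((n × n) ⊕ n) ℝ) := fun t =>
    ∑ k, (MvPolynomial.X (Sum.inr k) : MvPolynomial ((n × n) ⊕ n) ℝ) •
      (T t (b k)).map MvPolynomial.C
  let f : Option κ × n × n → MvPolynomial ((n × n) ⊕ n) ℝ := fun q =>
    (q.1.elim (Pm * Pm - Pm) fun t => (1 - Pm) * Tm t * Pm) q.2.1 q.2.2
  let ev : Matrix n n ℝ → E → MvPolynomial ((n × n) ⊕ n) ℝ →+* ℝ := fun P a =>
    MvPolynomial.eval (Sum.elim (fun q => P q.1 q.2) (b.equivFun a))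
  have hP : ∀ P a, (ev P a).mapMatrix Pm = P := fun P a => by
    ext i j; simp [ev, Pm]
  have hT : ∀ P a t, (ev P a).mapMatrix (Tm t) = T t a := fun P a t => by
    conv_rhs => rw [← b.sum_equivFun a, map_sum]
    simp only [Tm, map_sum]
    refine Finset.sum_congr rfl fun k _ => ?_
    ext i j
    simp [ev]
  have hnone : ∀ P a i j, ev P a (f (none, i, j)) = (P * P - P) i j := fun P a i j => by
    change (ev P a).mapMatrix (Pm * Pm - Pm) i j = _
    rw [map_sub, map_mul, hP]
  have hsome : ∀ P a t i j, ev P a (f (some t, i, j)) = ((1 - P) * T t a * P) i j :=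
    fun P a t i j => by
      change (ev P a).mapMatrix ((1 - Pm) * Tm t * Pm) i j = _
      rw [map_mul, map_mul, map_sub, map_one, hP, hT]
  obtain ⟨C, hC⟩ := MvPolynomial.exists_pow_forall_exists_common_zero f
  refine ⟨C, fun ρ hρ0 hρ P hPb hPP A hA hAb hAP => ?_⟩
  obtain ⟨y, hy, hyA⟩ := hC ρ hρ0 hρ (fun q => P q.1 q.2) (fun q => hPb _ _) (b.equivFun '' A)
    (by rintro _ ⟨a, ha, rfl⟩ i; exact hAb a ha i) (by
      rintro _ ⟨a, ha, rfl⟩ ⟨_ | t, i, j⟩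
      · refine (congrArg abs (hnone P a i j)).trans_le ?_
        rw [hPP, sub_self]
        simpa using pow_nonneg hρ0.le C
      · exact (congrArg abs (hsome P a t i j)).trans_le (hAP a ha t i j))
  let P' : Matrix n n ℝ := Matrix.of fun i j => y (i, j)
  have key : ∀ a ∈ A, ∃ a' : E, (∀ i, |b.repr (a - a') i| ≤ ρ) ∧ ∀ q, ev P' a' (f q) = 0 := by
    intro a ha
    obtain ⟨s, hs, hs0⟩ := hyA _ ⟨a, ha, rfl⟩
    refine ⟨b.equivFun.symm s, fun i => ?_, fun q => ?_⟩
    · have := hs i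
      rwa [← b.equivFun.apply_symm_apply s, ← Pi.sub_apply, ← map_sub] at this
    · have := hs0 q
      rwa [← b.equivFun.apply_symm_apply s] at this
  refine ⟨P', fun i j => hy (i, j), ?_, fun a ha => ?_⟩
  · obtain ⟨a, ha⟩ := hA
    obtain ⟨a', -, ha'⟩ := key a ha
    refine sub_eq_zero.1 (Matrix.ext fun i j => ?_)
    rw [← hnone P' a', ha', Matrix.zero_apply]
  · obtain ⟨a', h, ha'⟩ := key a ha
    refine ⟨a', h, fun t => Matrix.ext fun i j => ?_⟩
    rw [← hsome, ha', Matrix.zero_apply]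

theorem SDist.exists_lt {E : Type*} [AddCommGroup E] [Module ℝ E] {nm : Seminorm ℝ E} {x : E}
    {W : Set E} {r : ℝ} (hW : W.Nonempty) (h : SDist nm x W < r) : ∃ w ∈ W, nm (x - w) < r := by
  obtain ⟨_, ⟨w, hw, rfl⟩, hr⟩ := exists_lt_of_csInf_lt (hW.image _) h
  exact ⟨w, hw, hr⟩

theorem SDist.le_of_mem {E : Type*} [AddCommGroup E] [Module ℝ E] (nm : Seminorm ℝ E) (x : E)
    {W : Set E} {w : E} (hw : w ∈ W) : SDist nm x W ≤ nm (x - w) :=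
  csInf_le ⟨0, by rintro _ ⟨w, -, rfl⟩; exact apply_nonneg nm _⟩ ⟨w, hw, rfl⟩

/-- An `n × n` matrix that is entrywise closer than `1 / n` to a matrix of trace at least one is
nonzero. -/
theorem Matrix.ne_zero_of_one_le_trace {n : Type*} [Fintype n] {P P' : Matrix n n ℝ} {ρ : ℝ}
    (htr : 1 ≤ P.trace) (h : ∀ i j, |P i j - P' i j| ≤ ρ) (hρ : Fintype.card n * ρ < 1) :
    P' ≠ 0 := by
  rintro rfl
  have : P.trace ≤ ∑ _i : n, ρ := Finset.sum_le_sum fun i _ => by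
    simpa using (le_abs_self _).trans (h i i)
  rw [Finset.sum_const, Finset.card_univ, nsmul_eq_mul] at this
  linarith

/-- **Lemma 3.2**: if `A ⊆ B(0, ρ⁻¹)` is `ρ`-away from subalgebras in a simple normed
algebra, then for every proper nonzero linear subspace `W` there are `w ∈ W` with `‖w‖ ≤ 1`
and `a ∈ A` such that `aw` or `wa` is at distance at least `c ρ^C` from `W`. -/
theorem multiplicative_escape_from_subspaces
    {E : Type*} [Ring E] [Algebra ℝ E] [FiniteDimensional ℝ E] [IsSimpleRing E]
    (nm : Seminorm ℝ E) (hnm : ∀ x : E, nm x = 0 → x = 0) :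
    ∃ C : ℝ, 1 ≤ C ∧ ∃ c : ℝ, 0 < c ∧
      ∀ ρ : ℝ, 0 < ρ → ρ ≤ 1 / 2 →
        ∀ A : Set E,
          A ⊆ SBall nm 0 ρ⁻¹ →
          AwayFromSubalgebras nm ρ A →
          ∀ W : Submodule ℝ E, W ≠ ⊥ → W ≠ ⊤ →
            ∃ w ∈ W, nm w ≤ 1 ∧ ∃ a ∈ A,
              (c * ρ ^ C ≤ SDist nm (a * w) (W : Set E) ∨
                c * ρ ^ C ≤ SDist nm (w * a) (W : Set E)) := by
  let b := Module.finBasis ℝ E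
  set d := Module.finrank ℝ E with hd
  obtain ⟨M₀, hM₀, hM₀1, hM₀2⟩ := nm.exists_bound_repr b hnm
  obtain ⟨M, hM, hMd, hM1, hM2⟩ : ∃ M : ℝ, 1 ≤ M ∧ (d : ℝ) ≤ M ∧
      (∀ x : E, ∀ t : ℝ, 0 ≤ t → (∀ i, |b.repr x i| ≤ t) → nm x ≤ M * t) ∧
      ∀ x : E, ∀ i, |b.repr x i| ≤ M * nm x :=
    ⟨max M₀ d, hM₀.trans (le_max_left _ _), le_max_right _ _,
      fun x t ht h => (hM₀1 x t ht h).trans (by gcongr; exact le_max_left _ _),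
      fun x i => (hM₀2 x i).trans
        (mul_le_mul_of_nonneg_right (le_max_left _ _) (apply_nonneg nm x))⟩
  have hM0 : 0 < M := by linarith
  let T : Bool → E →ₗ[ℝ] E →ₗ[ℝ] E := fun t => t.rec (LinearMap.mul ℝ E) (LinearMap.mul ℝ E).flip
  obtain ⟨C, hC⟩ := exists_pow_forall_exists_idempotent b
    fun t => (LinearMap.toMatrix b b : (E →ₗ[ℝ] E) ≃ₗ[ℝ] _).toLinearMap ∘ₗ T t
  refine ⟨C + 1, by simp, (2 * M ^ 3 * (2 * M) ^ C)⁻¹, by positivity,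
    fun ρ hρ0 hρ A hAb hA W hbot htop => ?_⟩
  by_contra! hcon
  set ε := (2 * M ^ 3 * (2 * M) ^ C)⁻¹ * ρ ^ ((C : ℝ) + 1) with hε
  have hεle : 2 * M ^ 3 * ε ≤ (ρ / (2 * M)) ^ C := by
    have h1 : ρ ^ ((C : ℝ) + 1) ≤ ρ ^ C := by
      rw [Real.rpow_add_one hρ0.ne', Real.rpow_natCast]
      exact mul_le_of_le_one_right (by positivity) (by linarith)
    have h2 : 2 * M ^ 3 * ε = ρ ^ ((C : ℝ) + 1) / (2 * M) ^ C := by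
      rw [hε]; field_simp
    rw [h2, div_pow]
    gcongr
  have hε0 : 0 ≤ ε := by positivity
  obtain ⟨Q, hQ, hQb⟩ := exists_projection_toMatrix_le_one b W
  set P := LinearMap.toMatrix b b Q with hP
  have hPP : P * P = P := by
    rw [hP, ← LinearMap.toMatrix_mul]
    congr 1
    ext x
    exact hQ.map_id _ (hQ.map_mem x)
  have hρ' : 0 < ρ / (2 * M) := by positivity
  have hρM : ρ / (2 * M) ≤ 1 / 2 := (div_le_self hρ0.le (by linarith)).trans hρ
  have hinv : (ρ / (2 * M))⁻¹ = 2 * M * ρ⁻¹ := by rw [inv_div]; rfl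
  have hAne : A.Nonempty := by
    obtain ⟨a, ha, -⟩ := hA _ (Submodule.twoSidedStabilizer_ne_top hbot htop)
    exact ⟨a, ha⟩
  have hnear : ∀ a ∈ A, ∀ t, ∀ w ∈ W, nm w ≤ 1 → ∃ u ∈ W, nm (T t a w - u) < ε := by
    intro a ha t w hw hw1
    have := hcon w hw hw1 a ha
    cases t
    · exact SDist.exists_lt ⟨0, W.zero_mem⟩ this.1
    · exact SDist.exists_lt ⟨0, W.zero_mem⟩ this.2
  have hrepr : ∀ x i, b.repr (Q x) i = ∑ j, P i j * b.repr x j := fun x i =>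
    (congrFun (LinearMap.toMatrix_mulVec_repr b b Q x) i).symm
  have hsmall : ∀ a ∈ A, ∀ t i j,
      |((1 - P) * LinearMap.toMatrix b b (T t a) * P) i j| ≤ (ρ / (2 * M)) ^ C := by
    intro a ha t i j
    refine le_trans ?_ hεle
    have hent : ((1 - P) * LinearMap.toMatrix b b (T t a) * P) i j =
        b.repr (T t a (Q (b j)) - Q (T t a (Q (b j)))) i := by
      rw [hP, ← LinearMap.toMatrix_one b, ← map_sub, ← LinearMap.toMatrix_mul,
        ← LinearMap.toMatrix_mul, LinearMap.toMatrix_apply]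
      rfl
    have hq : nm (Q (b j)) ≤ M := by
      simpa using hM1 (Q (b j)) 1 zero_le_one fun k => by
        simpa [hP, LinearMap.toMatrix_apply] using hQb k j
    obtain ⟨u, hu, hlt⟩ := hnear a ha t (M⁻¹ • Q (b j)) (W.smul_mem _ (hQ.map_mem _)) (by
      rw [map_smul_eq_mul, Real.norm_of_nonneg (by positivity), inv_mul_le_one₀ hM0]
      exact hq)
    set z := T t a (M⁻¹ • Q (b j)) - u with hz
    have hz' : T t a (Q (b j)) - Q (T t a (Q (b j))) = M • (z - Q z) := by
      have h1 : T t a (Q (b j)) = M • (z + u) := by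
        rw [hz, sub_add_cancel, map_smul, smul_inv_smul₀ hM0.ne']
      rw [h1, map_smul, map_add, hQ.map_id u hu, ← smul_sub, add_sub_add_right_eq_sub]
    have hzb : ∀ k, |b.repr z k| ≤ M * ε := fun k => (hM2 z k).trans (by gcongr)
    have hQz : |b.repr (Q z) i| ≤ M * (M * ε) := by
      rw [hrepr]
      calc _ ≤ ∑ k, |P i k * b.repr z k| := Finset.abs_sum_le_sum_abs _ _
        _ ≤ ∑ _k : Fin d, M * ε := Finset.sum_le_sum fun k _ => by
          rw [abs_mul]
          exact (mul_le_of_le_one_left (abs_nonneg _) (hQb i k)).trans (hzb k)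
        _ = d * (M * ε) := by simp
        _ ≤ _ := by gcongr
    rw [hent, hz', map_smul, Finsupp.smul_apply, smul_eq_mul, abs_mul, abs_of_pos hM0, map_sub,
      Finsupp.sub_apply]
    calc _ ≤ M * (M * ε + M * (M * ε)) := by
          gcongr
          exact (abs_sub _ _).trans (add_le_add (hzb i) hQz)
      _ ≤ M * (M * (M * ε) + M * (M * ε)) := by
          gcongr
          exact le_mul_of_one_le_left (by positivity) hM
      _ = _ := by ring
  obtain ⟨P', hP'1, hP'2, hP'3⟩ := hC (ρ / (2 * M)) hρ' hρM P
    (fun i j => (hQb i j).trans ((one_le_inv₀ hρ').2 (by linarith))) hPP A hAne (by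
      intro a ha i
      have : nm a ≤ ρ⁻¹ := by simpa [SBall] using hAb ha
      rw [hinv]
      calc _ ≤ M * nm a := hM2 a i
        _ ≤ M * ρ⁻¹ := by gcongr
        _ ≤ 2 * M * ρ⁻¹ := by gcongr; linarith) hsmall
  have htr : P.trace = Module.finrank ℝ W := by
    rw [hP, ← LinearMap.trace_eq_matrix_trace, hQ.trace]
  have hW1 : 1 ≤ Module.finrank ℝ W := Nat.one_le_iff_ne_zero.2 fun h =>
    hbot (Submodule.finrank_eq_zero.1 h)
  have hWd : Module.finrank ℝ W + 1 ≤ d := Submodule.finrank_lt htop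
  have hcard : Fintype.card (Fin d) * (ρ / (2 * M)) < 1 := by
    rw [Fintype.card_fin]
    calc d * (ρ / (2 * M)) ≤ M * (ρ / (2 * M)) := by gcongr
      _ = ρ / 2 := by field_simp
      _ < 1 := by linarith
  have hP'0 : P' ≠ 0 := Matrix.ne_zero_of_one_le_trace
    (by rw [htr]; exact_mod_cast hW1) hP'1 hcard
  have hP'4 : 1 - P' ≠ 0 := Matrix.ne_zero_of_one_le_trace (P := 1 - P) (by
      rw [Matrix.trace_sub, Matrix.trace_one, htr, Fintype.card_fin]
      have : (Module.finrank ℝ W : ℝ) + 1 ≤ d := by exact_mod_cast hWd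
      linarith) (fun i j => by
      rw [Matrix.sub_apply, Matrix.sub_apply, sub_sub_sub_cancel_left, abs_sub_comm]
      exact hP'1 i j) hcard
  let Q' : E →ₗ[ℝ] E := Matrix.toLin b b P'
  have hQ'Q' : ∀ x, Q' (Q' x) = Q' x := fun x => by
    rw [← LinearMap.comp_apply, ← Matrix.toLin_mul, hP'2]
  obtain ⟨a, ha, hfar⟩ := hA _ (Submodule.twoSidedStabilizer_ne_top (W := Q'.range)
    (fun h => hP'0 (by simpa [Q'] using LinearMap.range_eq_bot.1 h))
    (fun h => hP'4 (by
      have : Q' = Matrix.toLin b b 1 := LinearMap.ext fun x => by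
        obtain ⟨y, rfl⟩ := LinearMap.range_eq_top.1 h x
        simp [hQ'Q']
      rw [(Matrix.toLin b b).injective this, sub_self])))
  obtain ⟨a', haa', ha'⟩ := hP'3 a ha
  have hstab : ∀ t, ∀ w ∈ Q'.range, T t a' w ∈ Q'.range := by
    rintro t _ ⟨x, rfl⟩
    have h : (LinearMap.id - Q') ∘ₗ T t a' ∘ₗ Q' = 0 := by
      have := congrArg (Matrix.toLin b b) (ha' t)
      simpa [Matrix.toLin_mul b b b, LinearMap.comp_assoc] using this
    refine ⟨T t a' (Q' x), (sub_eq_zero.1 ?_).symm⟩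
    exact LinearMap.congr_fun h x
  have hmem : a' ∈ (Q'.range.twoSidedStabilizer : Set E) :=
    fun w hw => ⟨hstab false w hw, hstab true w hw⟩
  have h1 := hfar.trans (SDist.le_of_mem nm a hmem)
  have h2 := hM1 (a - a') _ hρ'.le haa'
  have h3 : M * (ρ / (2 * M)) = ρ / 2 := by field_simp
  linarith
end
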